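/- arXiv:1105.0142 — 4 statements merged into one kernel-verified Lean document; each statement's English description precedes it below -/
import Mathlib

section
/- Let D be an integral domain with quotient field K ≠ D such that for every t-localizing t-maximal ideal p of D with D/p finite, the ideal pD_p of D_p is principal and Int(D_p) = Int(D)_p. Then Int(D) is locally free as a D-module: Int(D)_p is a free D_p-module for every prime ideal p of D. -/
namespace IVP

open Polynomial

variable {F : Type} [Field F]

/-- Integer-valued polynomials on the set `E` with values in `D`:
`Int(E,D) = {f ∈ F[X] : f(E) ⊆ D}`. -/
def IntOn (E D : Set F) : Set (Polynomial F) := {f | ∀ x ∈ E, f.eval x ∈ D}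

/-- `Int(D) = {f ∈ F[X] : f(D) ⊆ D}`. -/
def IntR (D : Set F) : Set (Polynomial F) := IntOn D D

/-- Polynomials with all coefficients in `R`, i.e. `R[X]` as a subset of `F[X]`. -/
def polySet (R : Set F) : Set (Polynomial F) := {f | ∀ n, f.coeff n ∈ R}

/-- `I⁻¹ = (D :_K I) = {x : x·I ⊆ D}`. -/
def dinv (D I : Set F) : Set F := {x | ∀ y ∈ I, x * y ∈ D}

/-- `I_v = (I⁻¹)⁻¹`. -/
def dv (D I : Set F) : Set F := dinv D (dinv D I)

/-- `I_t = ⋃ J_v`, the union over all nonzero finitely generated fractional ideals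
`J ⊆ I`; such a `J` is the `D`-span of a finite set `T ⊆ I` containing a nonzero
element, and `J_v` depends only on `T`. -/
def dt (D I : Set F) : Set F :=
  {x | ∃ T : Finset F, ↑T ⊆ I ∧ (∃ y ∈ T, y ≠ 0) ∧ x ∈ dv D ↑T}

/-- The image in `F` of a set of elements of the subring `D`. -/
def iset (D : Subring F) (I : Set ↥D) : Set F := (↑) '' I

/-- `I` is a t-ideal: `I_t = I`. -/
def IsTIdeal (D I : Set F) : Prop := dt D I = I

/-- `I` is a v-ideal: `I_v = I`. -/
def IsVIdeal (D I : Set F) : Prop := dv D I = I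

/-- `p` is a t-maximal ideal of `D`: maximal among the t-ideals properly contained
in `D`. -/
def IsTMax (D : Subring F) (p : Ideal ↥D) : Prop :=
  p ≠ ⊤ ∧ IsTIdeal ↑D (iset D ↑p) ∧
    ∀ q : Ideal ↥D, q ≠ ⊤ → IsTIdeal ↑D (iset D ↑q) → p ≤ q → p = q

/-- `p` is a v-maximal ideal of `D`: maximal among the v-ideals properly contained
in `D`. -/
def IsVMax (D : Subring F) (p : Ideal ↥D) : Prop :=
  p ≠ ⊤ ∧ IsVIdeal ↑D (iset D ↑p) ∧
    ∀ q : Ideal ↥D, q ≠ ⊤ → IsVIdeal ↑D (iset D ↑q) → p ≤ q → p = q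

/-- The localization `S⁻¹D` of `D` at a multiplicative subset `S ⊆ D`, as a subset
of `F`. -/
def mlocSet (D : Subring F) (S : Set ↥D) : Set F :=
  {x | ∃ a : ↥D, ∃ s ∈ S, (s : F) * x = (a : F)}

/-- The localization `D_p` of `D` at the complement of `p`, as a subset of `F`. -/
def plocSet (D : Subring F) (p : Ideal ↥D) : Set F := mlocSet D {s | s ∉ p}

/-- The localization `S⁻¹R` of a set `R` of polynomials at a multiplicative subset
`S ⊆ D`, as a subset of `F[X]`. -/
def mlocPoly (D : Subring F) (S : Set ↥D) (R : Set (Polynomial F)) : Set (Polynomial F) :=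
  {f | ∃ g ∈ R, ∃ s ∈ S, C (s : F) * f = g}

/-- The localization `R_p` of a set `R` of polynomials at `D ∖ p`. -/
def plocPoly (D : Subring F) (p : Ideal ↥D) (R : Set (Polynomial F)) : Set (Polynomial F) :=
  mlocPoly D {s | s ∉ p} R

/-- The ideal `pD_p` of the localization `D_p`, as a subset of `F`. -/
def plocIdl (D : Subring F) (p : Ideal ↥D) : Set F :=
  {x | ∃ y ∈ p, ∃ s : ↥D, s ∉ p ∧ (s : F) * x = ((y : ↥D) : F)}

/-- `p` is t-localizing: `pD_p` is a t-ideal of `D_p`. -/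
def TLocalizing (D : Subring F) (p : Ideal ↥D) : Prop :=
  IsTIdeal (plocSet D p) (plocIdl D p)

/-- `F` is the quotient field of `D`. -/
def IsQuotField (D : Subring F) : Prop :=
  ∀ x : F, ∃ a b : ↥D, b ≠ 0 ∧ (b : F) * x = (a : F)

/-- The quotient field of `D`, as a subset of the ambient field. -/
def fracSet (D : Subring F) : Set F :=
  {x | ∃ a b : ↥D, b ≠ 0 ∧ (b : F) * x = (a : F)}

/-- The conductor ideal `(aD :_D bD) = {d ∈ D : d·b ∈ aD}` of `D`. -/
def Conductor (D : Subring F) (a b : ↥D) : Set ↥D := {d | ∃ c : ↥D, d * b = a * c}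

/-- Elementwise product of two subsets of `F`. -/
def setMul (A B : Set F) : Set F := {z | ∃ x ∈ A, ∃ y ∈ B, z = x * y}

/-- The ideal `I` of `D` is t-invertible: `(I⁻¹I)_t = D`. -/
def TInv (D : Subring F) (I : Ideal ↥D) : Prop :=
  dt ↑D (setMul (dinv ↑D (iset D ↑I)) (iset D ↑I)) = (↑D : Set F)

/-- The ideal `I` of `D` is v-invertible: `(I⁻¹I)_v = D`. -/
def VInv (D : Subring F) (I : Ideal ↥D) : Prop :=
  dv ↑D (setMul (dinv ↑D (iset D ↑I)) (iset D ↑I)) = (↑D : Set F)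

/-- `D` is a PVMD: every nonzero finitely generated ideal of `D` is t-invertible. -/
def IsPVMD (D : Subring F) : Prop :=
  ∀ I : Ideal ↥D, I ≠ ⊥ → I.FG → TInv D I

/-- `D` is an H domain: every v-invertible nonzero ideal of `D` is t-invertible. -/
def IsHDomain (D : Subring F) : Prop :=
  ∀ I : Ideal ↥D, I ≠ ⊥ → VInv D I → TInv D I

/-- `p ∈ sKr(K/D)`: `p` is a prime such that every finitely generated ideal
`I ⊆ p` satisfies `I ⊆ J ⊆ p` for some conductor ideal `J` of `D`. -/
def SKrMem (D : Subring F) (p : Ideal ↥D) : Prop :=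
  p.IsPrime ∧ ∀ I : Ideal ↥D, I.FG → I ≤ p →
    ∃ a b : ↥D, a ≠ 0 ∧ (↑I : Set ↥D) ⊆ Conductor D a b ∧ Conductor D a b ⊆ ↑p

/-- The localization `A_p` of `A ⊇ D` at the complement in `D` of a prime `p` of `D`,
as a subset of the ambient field. -/
def mixedLocSet (D A : Subring F) (p : Ideal ↥D) : Set F :=
  {x | ∃ a : ↥A, ∃ s : ↥D, s ∉ p ∧ (s : F) * x = (a : F)}

/-- `pD_p` is a principal ideal of `D_p`. -/
def PLocPrincipal (D : Subring F) (p : Ideal ↥D) : Prop :=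
  ∃ g : F, plocIdl D p = {x | ∃ d ∈ plocSet D p, x = d * g}

/-- The localization `A_p` of `A ⊇ D` at a prime `p` of `D`, as a subring of the
ambient field. -/
def mixedLoc (D A : Subring F) (hDA : D ≤ A) (p : Ideal ↥D) (hp : p.IsPrime) :
    Subring F where
  carrier := mixedLocSet D A p
  one_mem' := ⟨1, 1, fun h => hp.ne_top (Ideal.eq_top_of_isUnit_mem p h isUnit_one), by simp⟩
  zero_mem' := ⟨0, 1, fun h => hp.ne_top (Ideal.eq_top_of_isUnit_mem p h isUnit_one), by simp⟩
  mul_mem' := by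
    rintro x y ⟨a, s, hs, hx⟩ ⟨b, t, ht, hy⟩
    refine ⟨a * b, s * t, fun h => ((hp.mem_or_mem h).elim hs ht), ?_⟩
    push_cast
    rw [mul_mul_mul_comm, hx, hy]
  add_mem' := by
    rintro x y ⟨a, s, hs, hx⟩ ⟨b, t, ht, hy⟩
    refine ⟨⟨t, hDA t.2⟩ * a + ⟨s, hDA s.2⟩ * b, s * t,
      fun h => ((hp.mem_or_mem h).elim hs ht), ?_⟩
    push_cast
    rw [mul_add]
    rw [show ((s:F) * t) * x = (t:F) * ((s:F) * x) by ring, hx,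
      show ((s:F) * t) * y = (s:F) * ((t:F) * y) by ring, hy]
  neg_mem' := by
    rintro x ⟨a, s, hs, hx⟩
    exact ⟨-a, s, hs, by push_cast; rw [mul_neg, hx]⟩

/-- The localization `D_p` of `D` at a prime `p`, as a subring of `F`. -/
def primeLoc (D : Subring F) (p : Ideal ↥D) (hp : p.IsPrime) : Subring F :=
  mixedLoc D D le_rfl p hp

/-- `Int(D)` as a subring of `F[X]`. -/
def IntSubring (D : Subring F) : Subring (Polynomial F) where
  carrier := IntR ↑D
  one_mem' := fun x _ => by simpa using D.one_mem
  zero_mem' := fun x _ => by simpa using D.zero_mem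
  mul_mem' := fun hf hg x hx => by
    rw [eval_mul]; exact D.mul_mem (hf x hx) (hg x hx)
  add_mem' := fun hf hg x hx => by
    rw [eval_add]; exact D.add_mem (hf x hx) (hg x hx)
  neg_mem' := fun hf x hx => by
    rw [eval_neg]; exact D.neg_mem (hf x hx)

/-- `Int(D)` as a `D`-submodule of `F[X]`. -/
def intSubmodule (D : Subring F) : Submodule ↥D (Polynomial F) where
  carrier := IntR ↑D
  zero_mem' := fun x _ => by simpa using D.zero_mem
  add_mem' := fun hf hg x hx => by
    rw [eval_add]; exact D.add_mem (hf x hx) (hg x hx)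
  smul_mem' := fun c f hf x hx => by
    have h : c • f = C (c : F) * f := by
      rw [Algebra.smul_def]; rfl
    rw [h, eval_mul, eval_C]
    exact D.mul_mem c.2 (hf x hx)

/-- An overring `D'` of `D` as a `D`-submodule of `F`. -/
def subringSubmodule (D D' : Subring F) (h : D ≤ D') : Submodule ↥D F where
  carrier := ↑D'
  zero_mem' := D'.zero_mem
  add_mem' := fun ha hb => D'.add_mem ha hb
  smul_mem' := fun c x hx => by
    rw [Subring.smul_def]
    exact D'.mul_mem (h c.2) hx

/-- `Int(D)_p` as a `D_p`-submodule of `F[X]`. -/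
def plocIntSubmodule (D : Subring F) (p : Ideal ↥D) (hp : p.IsPrime) :
    Submodule ↥(primeLoc D p hp) (Polynomial F) where
  carrier := plocPoly D p (IntR ↑D)
  zero_mem' :=
    ⟨0, fun x _ => by simpa using D.zero_mem, 1,
      fun h => hp.ne_top (Ideal.eq_top_of_isUnit_mem p h isUnit_one), by simp⟩
  add_mem' := by
    rintro f f' ⟨g, hg, s, hs, hfg⟩ ⟨g', hg', t, ht, hfg'⟩
    refine ⟨C (t : F) * g + C (s : F) * g', ?_, s * t,
      fun h => ((hp.mem_or_mem h).elim hs ht), ?_⟩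
    · intro x hx
      rw [eval_add, eval_mul, eval_mul, eval_C, eval_C]
      exact D.add_mem (D.mul_mem t.2 (hg x hx)) (D.mul_mem s.2 (hg' x hx))
    · rw [← hfg, ← hfg']
      push_cast
      rw [map_mul]
      ring
  smul_mem' := by
    rintro c f ⟨g, hg, t, ht, hfg⟩
    obtain ⟨a, s, hs, hsc⟩ := c.2
    have h : c • f = C (c : F) * f := by rw [Algebra.smul_def]; rfl
    refine ⟨C (a : F) * g, ?_, s * t,
      fun hmem => ((hp.mem_or_mem hmem).elim hs ht), ?_⟩
    · intro x hx
      rw [eval_mul, eval_C]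
      exact D.mul_mem a.2 (hg x hx)
    · rw [h, ← hfg, ← hsc]
      push_cast
      rw [map_mul, map_mul]
      ring

section Extensions

variable {L : Type} [Field L]

/-- The data of an extension: the subring `A` of `L` contains the image of `D`
under the embedding `φ` of quotient fields. -/
def ExtMem (D : Subring F) (φ : F →+* L) (A : Subring L) : Prop := ∀ d : ↥D, φ d ∈ A

/-- The injective ring homomorphism `D → A` induced by `φ`. -/
noncomputable def extHom (D : Subring F) (φ : F →+* L) (A : Subring L)
    (h : ExtMem D φ A) : ↥D →+* ↥A :=
  (φ.comp D.subtype).codRestrict A.toSubsemiring (fun d => h d)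

/-- The extension `A ⊇ D` is polynomially regular: `Int(D,A) = A·Int(D)`. -/
def PolyReg (D : Subring F) (φ : F →+* L) (A : Subring L) : Prop :=
  IntOn (φ '' ↑D) ↑A = ↑(Submodule.span ↥A (Polynomial.map φ '' IntR (↑D : Set F)))

/-- The extension `A ⊇ D` is weakly polynomially complete: `Int(D) ⊆ Int(A)`. -/
def WPolyComplete (D : Subring F) (φ : F →+* L) (A : Subring L) : Prop :=
  Polynomial.map φ '' IntR (↑D : Set F) ⊆ IntR (↑A : Set L)

/-- The extension `A ⊇ D` is polynomially complete: `Int(D,A) = Int(A)`. -/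
def PolyComplete (D : Subring F) (φ : F →+* L) (A : Subring L) : Prop :=
  IntOn (φ '' ↑D) ↑A = IntR (↑A : Set L)

/-- The extension `A ⊇ D` is flat: `A` is flat as a `D`-module. -/
def ExtFlat (D : Subring F) (φ : F →+* L) (A : Subring L) (h : ExtMem D φ A) : Prop :=
  letI : Module ↥D ↥A := Module.compHom ↥A (extHom D φ A h)
  Module.Flat ↥D ↥A

/-- The extension `A ⊇ D` is t-linked: `I_t = D` implies `(IA)_t = A` for every
nonzero ideal `I` of `D`. -/
def TLinkedExt (D : Subring F) (φ : F →+* L) (A : Subring L) (h : ExtMem D φ A) : Prop :=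
  ∀ I : Ideal ↥D, I ≠ ⊥ → dt ↑D (iset D ↑I) = (↑D : Set F) →
    dt ↑A (iset A ↑(Ideal.map (extHom D φ A h) I)) = (↑A : Set L)

/-- `D` is absolutely polynomially regular: every extension of `D` is polynomially
regular. -/
def AbsPolyReg (D : Subring F) : Prop :=
  ∀ (L : Type) [Field L], ∀ (φ : F →+* L) (A : Subring L),
    ExtMem D φ A → IsQuotField A → PolyReg D φ A

/-- `D` is polynomially F-regular: every flat extension of `D` is polynomially
regular. -/
def PFReg (D : Subring F) : Prop :=
  ∀ (L : Type) [Field L], ∀ (φ : F →+* L) (A : Subring L) (h : ExtMem D φ A),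
    IsQuotField A → ExtFlat D φ A h → PolyReg D φ A

/-- `D` is polynomially t-regular: every t-linked extension of `D` is polynomially
regular. -/
def PTReg (D : Subring F) : Prop :=
  ∀ (L : Type) [Field L], ∀ (φ : F →+* L) (A : Subring L) (h : ExtMem D φ A),
    IsQuotField A → TLinkedExt D φ A h → PolyReg D φ A

/-- `D` is polynomially L-regular: `Int(S⁻¹D) = S⁻¹Int(D)` for every multiplicative
subset `S` of `D` with `0 ∉ S`. -/
def PLReg (D : Subring F) : Prop :=
  ∀ S : Submonoid ↥D, (0 : ↥D) ∉ S →
    IntR (mlocSet D ↑S) = mlocPoly D ↑S (IntR (↑D : Set F))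

end Extensions

/-- The extension of an ideal `I` of `R` to an overring `S` of `R` inside a common
field: the ideal `IS` of `S` generated by `I`. -/
def extIdeal (R S : Subring F) (I : Ideal ↥R) : Ideal ↥S :=
  Ideal.span {y : ↥S | (y : F) ∈ iset R ↑I}

/-- Within a common field: `S` is a t-linked extension of `R`. -/
def TLinkedSub (R S : Subring F) : Prop :=
  R ≤ S ∧ ∀ I : Ideal ↥R, I ≠ ⊥ → dt ↑R (iset R ↑I) = (↑R : Set F) →
    dt ↑S (iset S ↑(extIdeal R S I)) = (↑S : Set F)

/-- Localization of a subset `R` of the ambient field at `D ∖ q`. -/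
def locOfSet (D : Subring F) (R : Set F) (q : Ideal ↥D) : Set F :=
  {x | ∃ y ∈ R, ∃ s : ↥D, s ∉ q ∧ (s : F) * x = y}

end IVP

open IVP Polynomial

/-- A submodule of `F[X]` over a subring of `F` that is spanned by a sequence of polynomials
having one member of each degree is free. -/
theorem free_of_eq_span_degree_eq {F : Type} [Field F] {R : Subring F}
    (N : Submodule ↥R F[X]) (f : ℕ → F[X]) (hdeg : ∀ n, (f n).degree = n)
    (hN : N = Submodule.span ↥R (Set.range f)) : Module.Free ↥R ↥N := by
  have hli : LinearIndependent F f := Sequence.linearIndependent ⟨f, hdeg⟩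
  subst hN
  exact Module.Free.of_basis (Module.Basis.span (hli.restrict_scalars' ↥R))

theorem free_of_coe_eq_polySet {F : Type} [Field F] {R : Subring F}
    (N : Submodule ↥R F[X]) (hN : (N : Set F[X]) = polySet (R : Set F)) :
    Module.Free ↥R ↥N := by
  refine free_of_eq_span_degree_eq N (fun n => X ^ n) (fun n => degree_X_pow n) (le_antisymm ?_ ?_)
  · intro g hg
    have hg' : g ∈ polySet (R : Set F) := hN ▸ hg
    rw [g.as_sum_range]
    refine Submodule.sum_mem _ fun i _ => ?_
    have h : monomial i (g.coeff i) = (⟨g.coeff i, hg' i⟩ : ↥R) • (X ^ i : F[X]) := by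
      rw [Subring.smul_def, smul_X_eq_monomial]
    rw [h]
    exact Submodule.smul_mem _ _ (Submodule.subset_span ⟨i, rfl⟩)
  · rw [Submodule.span_le]
    rintro _ ⟨n, rfl⟩
    rw [hN]
    intro i
    simp only [coeff_X_pow]
    split_ifs
    exacts [R.one_mem, R.zero_mem]

/-- Newton interpolation: polynomials of `N` that are dual to a sequence of evaluation points in
a triangular sense span `N`. -/
theorem free_of_triangular_eval {F : Type} [Field F] {R : Subring F}
    (N : Submodule ↥R F[X]) (f : ℕ → F[X]) (a : ℕ → F) (hdeg : ∀ n, (f n).degree = n)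
    (hf : ∀ n, f n ∈ N) (hone : ∀ n, (f n).eval (a n) = 1)
    (hzero : ∀ n, ∀ k < n, (f n).eval (a k) = 0) (hval : ∀ g ∈ N, ∀ n, g.eval (a n) ∈ R) :
    Module.Free ↥R ↥N := by
  have hle : Submodule.span ↥R (Set.range f) ≤ N := by
    rw [Submodule.span_le]
    rintro _ ⟨n, rfl⟩
    exact hf n
  refine free_of_eq_span_degree_eq N f hdeg (le_antisymm ?_ hle)
  intro g hg
  have key : ∀ m : ℕ, ∃ h ∈ Submodule.span ↥R (Set.range f),
      h.degree < m ∧ ∀ j < m, (g - h).eval (a j) = 0 := by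
    intro m
    induction m with
    | zero => exact ⟨0, Submodule.zero_mem _, by simp, by simp⟩
    | succ m ih =>
      obtain ⟨h, hh, hd, hv⟩ := ih
      let c : ↥R := ⟨(g - h).eval (a m), hval _ (N.sub_mem hg (hle hh)) m⟩
      refine ⟨h + c • f m, Submodule.add_mem _ hh
        (Submodule.smul_mem _ _ (Submodule.subset_span ⟨m, rfl⟩)), ?_, ?_⟩
      · refine (degree_add_le _ _).trans_lt (max_lt ?_ ?_)
        · exact hd.trans (by exact_mod_cast Nat.lt_succ_self m)
        · rw [Subring.smul_def]
          refine (degree_smul_le _ _).trans_lt ?_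
          rw [hdeg]
          exact_mod_cast Nat.lt_succ_self m
      · intro j hj
        rw [← sub_sub, eval_sub, Subring.smul_def, eval_smul]
        rcases Nat.lt_succ_iff_lt_or_eq.1 hj with hj | rfl
        · rw [hv j hj, hzero m j hj, smul_zero, sub_zero]
        · rw [hone, smul_eq_mul, mul_one, sub_self]
  have hinj : Function.Injective a := by
    intro i j hij
    rcases lt_trichotomy i j with h | h | h
    · have := hzero j i h
      rw [hij, hone] at this
      exact absurd this one_ne_zero
    · exact h
    · have := hzero i j h
      rw [← hij, hone] at this
      exact absurd this one_ne_zero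
  obtain ⟨h, hh, hd, hv⟩ := key (g.natDegree + 1)
  have h0 : g - h = 0 := by
    refine eq_zero_of_degree_lt_of_eval_index_eq_zero (Finset.range (g.natDegree + 1))
      (v := a) hinj.injOn ?_ ?_
    · rw [Finset.card_range]
      refine (degree_sub_le _ _).trans_lt (max_lt ?_ hd)
      exact degree_le_natDegree.trans_lt (by exact_mod_cast Nat.lt_succ_self _)
    · intro i hi
      exact hv i (Finset.mem_range.1 hi)
  rw [sub_eq_zero.1 h0]
  exact hh

/-- If every nonunit is divisible by the nonunit `π`, then `π` is prime. -/
theorem prime_of_isUnit_or_dvd {R : Type} [CommRing R] {π : R} (h0 : π ≠ 0)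
    (hnu : ¬ IsUnit π) (hloc : ∀ x : R, IsUnit x ∨ π ∣ x) : Prime π := by
  refine ⟨h0, hnu, fun x y hxy => ?_⟩
  rcases hloc x with hx | hx
  · rcases hloc y with hy | hy
    · exact absurd (isUnit_of_dvd_unit hxy (hx.mul hy)) hnu
    · exact Or.inr hy
  · exact Or.inl hx

/-- Among the values of a polynomial, one that is least divisible by `π` divides all others. -/
theorem exists_eval_dvd_eval {R : Type} [CommRing R] [IsDomain R] {π : R}
    (hloc : ∀ x : R, IsUnit x ∨ π ∣ x) (G : R[X])
    (hG : ∃ x, FiniteMultiplicity π (G.eval x)) :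
    ∃ a, G.eval a ≠ 0 ∧ ∀ x, G.eval a ∣ G.eval x := by
  classical
  have hex : ∃ n, ∃ x, ¬ π ^ (n + 1) ∣ G.eval x := by
    obtain ⟨x, n, hn⟩ := hG
    exact ⟨n, x, hn⟩
  obtain ⟨a, ha⟩ := Nat.find_spec hex
  have hmin : ∀ x, π ^ Nat.find hex ∣ G.eval x := by
    intro x
    rcases Nat.eq_zero_or_pos (Nat.find hex) with h | h
    · rw [h, pow_zero]
      exact one_dvd _
    · by_contra hx
      refine Nat.find_min hex (Nat.sub_lt h one_pos) ⟨x, ?_⟩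
      rwa [Nat.sub_add_cancel (Nat.one_le_iff_ne_zero.2 h.ne')]
  refine ⟨a, fun h => ha (h ▸ dvd_zero _), fun x => ?_⟩
  obtain ⟨u, hu⟩ := hmin a
  have huu : IsUnit u := by
    refine (hloc u).resolve_right fun hd => ha ?_
    rw [hu, pow_succ]
    exact mul_dvd_mul_left _ hd
  rw [hu]
  exact (huu.mul_right_dvd).2 (hmin x)

/-- Only one power of a prime `π` can agree with a given element modulo all powers of `π`. -/
theorem subsingleton_not_finiteMultiplicity_pow_sub {R : Type} [CommRing R] [IsDomain R] {π : R}
    (hπ : Prime π) (a : R) : {i : ℕ | ¬ FiniteMultiplicity π (π ^ i - a)}.Subsingleton := by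
  have key : ∀ i j : ℕ, i < j → ¬ FiniteMultiplicity π (π ^ i - a) →
      ¬ FiniteMultiplicity π (π ^ j - a) → False := by
    intro i j hij hi hj
    rw [FiniteMultiplicity.not_iff_forall] at hi hj
    have h := dvd_sub (hi (i + 1)) (hj (i + 1))
    rw [sub_sub_sub_cancel_right] at h
    have h' := (dvd_sub_left (pow_dvd_pow π hij)).1 h
    rw [pow_succ] at h'
    have h2 : π ^ i * π ∣ π ^ i * 1 := by rwa [mul_one]
    exact hπ.not_isUnit (isUnit_of_dvd_one ((mul_dvd_mul_iff_left (pow_ne_zero i hπ.ne_zero)).1 h2))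
  intro i hi j hj
  rcases lt_trichotomy i j with h | h | h
  · exact (key i j h hi hj).elim
  · exact h
  · exact (key j i h hj hi).elim

/-- A sequence `a` together with the products `G n = ∏_{k < n} (X - a k)` such that the value of
`G n` at `a n` is nonzero and divides all values of `G n`. -/
theorem exists_pi_ordering {R : Type} [CommRing R] [IsDomain R] {π : R}
    (hπ : Prime π) (hloc : ∀ x : R, IsUnit x ∨ π ∣ x) :
    ∃ (a : ℕ → R) (G : ℕ → R[X]), G 0 = 1 ∧ (∀ n, G (n + 1) = G n * (X - C (a n))) ∧
      ∀ n, (G n).eval (a n) ≠ 0 ∧ ∀ x, (G n).eval (a n) ∣ (G n).eval x := by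
  classical
  have hex : ∀ H : R[X], ∃ a : R, (∃ x, FiniteMultiplicity π (H.eval x)) →
      H.eval a ≠ 0 ∧ ∀ x, H.eval a ∣ H.eval x := by
    intro H
    by_cases hH : ∃ x, FiniteMultiplicity π (H.eval x)
    · obtain ⟨a, ha⟩ := exists_eval_dvd_eval hloc H hH
      exact ⟨a, fun _ => ha⟩
    · exact ⟨0, fun h => absurd h hH⟩
  choose α hα using hex
  let G : ℕ → R[X] := fun n => Nat.rec 1 (fun _ H => H * (X - C (α H))) n
  have hG : ∀ n, G (n + 1) = G n * (X - C (α (G n))) := fun n => rfl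
  have hfin : ∀ n, {i : ℕ | ¬ FiniteMultiplicity π ((G n).eval (π ^ i))}.Finite := by
    intro n
    induction n with
    | zero =>
      convert Set.finite_empty
      ext i
      simp only [Set.mem_ofPred_eq, Set.mem_empty_iff_false, iff_false, not_not]
      change FiniteMultiplicity π ((1 : R[X]).eval (π ^ i))
      rw [eval_one]
      refine ⟨0, fun h => hπ.not_isUnit (isUnit_of_dvd_one ?_)⟩
      simpa using h
    | succ n ih =>
      refine (ih.union (subsingleton_not_finiteMultiplicity_pow_sub hπ (α (G n))).finite).subset ?_
      intro i hi
      by_contra hcon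
      rw [Set.mem_union, not_or] at hcon
      simp only [Set.mem_ofPred_eq, not_not] at hcon hi
      refine hi ?_
      rw [hG, eval_mul, eval_sub, eval_X, eval_C]
      exact (FiniteMultiplicity.mul_iff hπ).2 hcon
  refine ⟨fun n => α (G n), G, rfl, hG, fun n => hα (G n) ?_⟩
  obtain ⟨i, hi⟩ := (hfin n).exists_notMem
  exact ⟨π ^ i, not_not.1 hi⟩

/-- `Int(R)` is free over a local domain `R` whose maximal ideal is generated by a nonzero
element. -/
theorem free_of_coe_eq_intR {F : Type} [Field F] {R : Subring F} (π : ↥R) (h0 : π ≠ 0)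
    (hnu : ¬ IsUnit π) (hloc : ∀ x : ↥R, IsUnit x ∨ π ∣ x)
    (N : Submodule ↥R F[X]) (hN : (N : Set F[X]) = IntR (R : Set F)) :
    Module.Free ↥R ↥N := by
  obtain ⟨a, G, hG0, hG, hGa⟩ := exists_pi_ordering (prime_of_isUnit_or_dvd h0 hnu hloc) hloc
  have hmem : ∀ g : F[X], g ∈ N ↔ ∀ x ∈ R, g.eval x ∈ R := fun g => by
    rw [← SetLike.mem_coe, hN]
    rfl
  have hmonic : ∀ n, (G n).Monic := by
    intro n
    induction n with
    | zero => rw [hG0]; exact monic_one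
    | succ n ih => rw [hG]; exact ih.mul (monic_X_sub_C _)
  have hdeg : ∀ n, (G n).degree = n := by
    intro n
    induction n with
    | zero => rw [hG0, degree_one]; rfl
    | succ n ih => rw [hG, degree_mul, ih, degree_X_sub_C]; rfl
  have hzero : ∀ n, ∀ k < n, (G n).eval (a k) = 0 := by
    intro n
    induction n with
    | zero => exact fun k hk => absurd hk (Nat.not_lt_zero k)
    | succ n ih =>
      intro k hk
      rw [hG, eval_mul]
      rcases Nat.lt_succ_iff_lt_or_eq.1 hk with hk | rfl
      · rw [ih k hk, zero_mul]
      · simp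
  have heval : ∀ n (x : ↥R), ((G n).map R.subtype).eval (x : F) = (((G n).eval x : ↥R) : F) :=
    fun n x => eval_map_apply (f := R.subtype) x
  have hne : ∀ n, (((G n).eval (a n) : ↥R) : F) ≠ 0 := fun n h => (hGa n).1 (Subtype.ext h)
  refine free_of_triangular_eval N
    (fun n => C (((G n).eval (a n) : ↥R) : F)⁻¹ * (G n).map R.subtype) (fun n => (a n : F))
    ?_ ?_ ?_ ?_ ?_
  · intro n
    rw [degree_C_mul (inv_ne_zero (hne n)), (hmonic n).degree_map, hdeg]
  · intro n
    rw [hmem]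
    intro x hx
    obtain ⟨c, hc⟩ := (hGa n).2 ⟨x, hx⟩
    have h := heval n ⟨x, hx⟩
    rw [eval_mul, eval_C, show x = ((⟨x, hx⟩ : ↥R) : F) from rfl, heval, hc, Subring.coe_mul,
      inv_mul_cancel_left₀ (hne n)]
    exact c.2
  · intro n
    rw [eval_mul, eval_C, heval, inv_mul_cancel₀ (hne n)]
  · intro n k hk
    rw [eval_mul, eval_C, heval, hzero n k hk, Subring.coe_zero, mul_zero]
  · intro g hg n
    exact (hmem g).1 hg _ (a n).2

theorem mem_primeLoc_of_mul_mem {F : Type} [Field F] {D : Subring F} {p : Ideal ↥D}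
    (hp : p.IsPrime) {s : ↥D} (hs : s ∉ p) {x : F} (h : (s : F) * x ∈ D) :
    x ∈ primeLoc D p hp :=
  ⟨⟨_, h⟩, s, hs, rfl⟩

theorem le_primeLoc {F : Type} [Field F] {D : Subring F} {p : Ideal ↥D} (hp : p.IsPrime) :
    D ≤ primeLoc D p hp := fun x hx =>
  mem_primeLoc_of_mul_mem hp ((Ideal.ne_top_iff_one p).1 hp.ne_top) (by simpa using hx)

theorem ne_zero_of_notMem {F : Type} [Field F] {D : Subring F} {p : Ideal ↥D} {s : ↥D}
    (hs : s ∉ p) : (s : F) ≠ 0 := fun h =>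
  hs ((Subtype.ext h : s = 0) ▸ p.zero_mem)

theorem inv_mem_primeLoc {F : Type} [Field F] {D : Subring F} {p : Ideal ↥D} (hp : p.IsPrime)
    {s : ↥D} (hs : s ∉ p) : (s : F)⁻¹ ∈ primeLoc D p hp :=
  mem_primeLoc_of_mul_mem hp hs (by rw [mul_inv_cancel₀ (ne_zero_of_notMem hs)]; exact D.one_mem)

/-- An element of `D_p` outside `pD_p` is a unit of `D_p`. -/
theorem inv_mem_primeLoc_of_notMem_plocIdl {F : Type} [Field F] {D : Subring F} {p : Ideal ↥D}
    (hp : p.IsPrime) {x : F} (hx : x ∈ primeLoc D p hp) (hx' : x ∉ plocIdl D p) :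
    x ≠ 0 ∧ x⁻¹ ∈ primeLoc D p hp := by
  obtain ⟨a, s, hs, h⟩ := hx
  have ha : a ∉ p := fun ha => hx' ⟨a, ha, s, hs, h⟩
  have hs0 : (s : F) ≠ 0 := ne_zero_of_notMem hs
  have hx0 : x ≠ 0 := fun h0 => ne_zero_of_notMem ha (by rw [← h, h0, mul_zero])
  refine ⟨hx0, s, a, ha, ?_⟩
  rw [← h, mul_assoc, mul_inv_cancel₀ hx0, mul_one]

theorem plocIdl_subset_primeLoc {F : Type} [Field F] {D : Subring F} {p : Ideal ↥D}
    (hp : p.IsPrime) {x : F} (hx : x ∈ plocIdl D p) : x ∈ primeLoc D p hp := by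
  obtain ⟨y, -, s, hs, h⟩ := hx
  exact ⟨y, s, hs, h⟩

theorem inv_notMem_primeLoc_of_mem_plocIdl {F : Type} [Field F] {D : Subring F} {p : Ideal ↥D}
    (hp : p.IsPrime) {x : F} (hx : x ∈ plocIdl D p) (hx0 : x ≠ 0) :
    x⁻¹ ∉ primeLoc D p hp := by
  obtain ⟨y, hy, s, hs, h⟩ := hx
  rintro ⟨b, t, ht, h'⟩
  have h2 : s * t = y * b := by
    refine Subtype.ext ?_
    push_cast
    rw [← h, ← h']
    field_simp
  exact (hp.mem_or_mem (h2 ▸ p.mul_mem_right b hy : s * t ∈ p)).elim hs ht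

/-- If `D/p` is infinite, then `Int(D) ⊆ D_p[X]`. -/
theorem coeff_mem_primeLoc_of_infinite {F : Type} [Field F] {D : Subring F} {p : Ideal ↥D}
    (hp : p.IsPrime) [Infinite (↥D ⧸ p)] {f : F[X]} (hf : f ∈ IntR (D : Set F)) (n : ℕ) :
    f.coeff n ∈ primeLoc D p hp := by
  classical
  let e := Infinite.natEmbedding (↥D ⧸ p)
  choose a ha using fun i => Ideal.Quotient.mk_surjective (e i)
  have hsub : ∀ i j, i ≠ j → a i - a j ∉ p := by
    intro i j hij h
    rw [← Ideal.Quotient.eq, ha, ha] at h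
    exact hij (e.injective h)
  have hinj : Function.Injective fun i => (a i : F) := by
    intro i j hij
    by_contra hne
    refine hsub i j hne ?_
    rw [Subtype.ext hij, sub_self]
    exact p.zero_mem
  have hint := Lagrange.eq_interpolate (f := f) (s := Finset.range (f.natDegree + 1))
    (v := fun i => (a i : F)) hinj.injOn (by
      rw [Finset.card_range]
      exact degree_le_natDegree.trans_lt (by exact_mod_cast Nat.lt_succ_self _))
  set R := primeLoc D p hp
  have hC : ∀ c ∈ R, (C c : F[X]) ∈ lifts R.subtype := fun c hc => C_mem_lifts R.subtype ⟨c, hc⟩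
  have hmem : f ∈ lifts R.subtype := by
    rw [hint, Lagrange.interpolate_apply]
    refine sum_mem fun i _ => mul_mem (hC _ (le_primeLoc hp (hf _ (a i).2))) ?_
    rw [Lagrange.basis]
    refine prod_mem fun j hj => ?_
    rw [Lagrange.basisDivisor]
    refine mul_mem (hC _ ?_) ?_
    · exact inv_mem_primeLoc hp (hsub i j (Finset.ne_of_mem_erase hj).symm)
    · rw [sub_eq_add_neg, ← C_neg]
      exact add_mem (X_mem_lifts _) (hC _ (R.neg_mem (le_primeLoc hp (a j).2)))
  obtain ⟨c, hc⟩ := (lifts_iff_coeff_lifts f).1 hmem n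
  rw [← hc]
  exact c.2

/-- The ideal `(D :_D c)` of `D`. -/
def denomIdeal {F : Type} [Field F] (D : Subring F) (c : F) : Ideal ↥D where
  carrier := {d | (d : F) * c ∈ D}
  zero_mem' := by simp [D.zero_mem]
  add_mem' := fun {x y} hx hy => by
    simp only [Set.mem_ofPred_eq, Subring.coe_add, add_mul] at *
    exact D.add_mem hx hy
  smul_mem' := fun r x hx => by
    simp only [Set.mem_ofPred_eq, smul_eq_mul, Subring.coe_mul, mul_assoc] at *
    exact D.mul_mem r.2 hx

theorem mem_primeLoc_of_not_denomIdeal_le {F : Type} [Field F] {D : Subring F} {p : Ideal ↥D}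
    (hp : p.IsPrime) {c : F} (h : ¬ denomIdeal D c ≤ p) : c ∈ primeLoc D p hp := by
  obtain ⟨s, hs, hsp⟩ := SetLike.not_le_iff_exists.1 h
  exact mem_primeLoc_of_mul_mem hp hsp hs

theorem notMem_primeLoc_of_denomIdeal_le {F : Type} [Field F] {D : Subring F} {p : Ideal ↥D}
    (hp : p.IsPrime) {c : F} (h : denomIdeal D c ≤ p) : c ∉ primeLoc D p hp := by
  rintro ⟨b, s, hs, hb⟩
  refine hs (h ?_)
  change (s : F) * c ∈ D
  rw [hb]
  exact b.2

/-- If a coefficient `c` of some member of `Int(D)` is not in `D_p`, then `D/p` is finite and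
some power of each element of `pD_p` multiplies `c` into `D_p`. -/
theorem finite_and_pow_mul_mem {F : Type} [Field F] {D : Subring F} {p : Ideal ↥D}
    (hp : p.IsPrime) {f : F[X]} (hf : f ∈ IntR (D : Set F)) {n : ℕ}
    (hc : f.coeff n ∉ primeLoc D p hp) :
    Finite (↥D ⧸ p) ∧ ∀ t ∈ plocIdl D p, ∃ k : ℕ, t ^ k * f.coeff n ∈ primeLoc D p hp := by
  have hfin : ∀ q : Ideal ↥D, q.IsPrime → denomIdeal D (f.coeff n) ≤ q → Finite (↥D ⧸ q) := by
    intro q hq hle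
    by_contra hinf
    rw [not_finite_iff_infinite] at hinf
    exact notMem_primeLoc_of_denomIdeal_le hq hle (coeff_mem_primeLoc_of_infinite hq hf n)
  have hIp : denomIdeal D (f.coeff n) ≤ p := by
    by_contra h
    exact hc (mem_primeLoc_of_not_denomIdeal_le hp h)
  have hmin : p ∈ (denomIdeal D (f.coeff n)).minimalPrimes := by
    refine ⟨⟨hp, hIp⟩, ?_⟩
    rintro q ⟨hq, hIq⟩ hqp
    have := hfin q hq hIq
    have hmax : q.IsMaximal := Ideal.Quotient.maximal_of_isField q (Finite.isField_of_domain _)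
    exact (hmax.eq_of_le hp.ne_top hqp).ge
  refine ⟨hfin p hp hIp, ?_⟩
  rintro t ⟨y, hy, s, hs, h⟩
  obtain ⟨k, r, hr, hk⟩ : ∃ (k : ℕ) (r : ↥D), r ∉ p ∧ r * y ^ k ∈ denomIdeal D (f.coeff n) := by
    by_contra hcon
    push Not at hcon
    obtain ⟨q, hq, hIq, hdis⟩ := Ideal.exists_le_prime_disjoint (denomIdeal D (f.coeff n))
      (p.primeCompl ⊔ Submonoid.powers y) (by
        rw [Set.disjoint_left]
        intro z hz hz'
        obtain ⟨r, hr, w, ⟨k, rfl⟩, rfl⟩ := Submonoid.mem_sup.1 hz'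
        exact hcon k r hr hz)
    rw [Set.disjoint_left] at hdis
    have hqp : q ≤ p := by
      intro z hz
      by_contra hzp
      exact hdis hz (Submonoid.mem_sup_left (show z ∈ p.primeCompl from hzp))
    exact hdis (hmin.2 ⟨hq, hIq⟩ hqp hy) (Submonoid.mem_sup_right (Submonoid.mem_powers y))
  refine ⟨k, ?_⟩
  have hrs : r * s ^ k ∉ p := fun hmem =>
    (hp.mem_or_mem hmem).elim hr fun h' => hs (hp.mem_of_pow_mem k h')
  refine mem_primeLoc_of_mul_mem hp hrs ?_
  have hk' : ((r * y ^ k : ↥D) : F) * f.coeff n ∈ D := hk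
  convert hk' using 1
  push_cast
  rw [← h]
  ring

/-- If powers of the elements of a finite set `T ⊆ R` multiply `c ∉ R` into `R`, then a single
element outside `R` is multiplied into `R` by all of `T`. -/
theorem exists_notMem_forall_mul_mem {F : Type} [Field F] {R : Subring F} {c : F} (hc : c ∉ R)
    (T : Finset F) (hT : ∀ t ∈ T, t ∈ R ∧ ∃ k : ℕ, t ^ k * c ∈ R) :
    ∃ m ∈ R, m * c ∉ R ∧ ∀ t ∈ T, t * (m * c) ∈ R := by
  classical
  induction T using Finset.induction_on with
  | empty => exact ⟨1, R.one_mem, by simpa using hc, by simp⟩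
  | insert t T ht ih =>
    obtain ⟨m, hm, hmc, hmT⟩ := ih fun u hu => hT u (Finset.mem_insert_of_mem hu)
    obtain ⟨htR, k, hk⟩ := hT t (Finset.mem_insert_self t T)
    have hex : ∃ k : ℕ, t ^ k * (m * c) ∈ R :=
      ⟨k, by rw [mul_left_comm]; exact R.mul_mem hm hk⟩
    obtain ⟨j, hj⟩ : ∃ j, Nat.find hex = j + 1 := by
      refine Nat.exists_eq_succ_of_ne_zero fun h0 => hmc ?_
      have := Nat.find_spec hex
      rwa [h0, pow_zero, one_mul] at this
    have hspec := Nat.find_spec hex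
    rw [hj] at hspec
    refine ⟨t ^ j * m, R.mul_mem (R.pow_mem htR j) hm, ?_, ?_⟩
    · rw [mul_assoc]
      exact Nat.find_min hex (hj ▸ Nat.lt_succ_self j)
    · intro u hu
      rcases Finset.mem_insert.1 hu with rfl | hu
      · rwa [mul_assoc, ← mul_assoc, ← pow_succ']
      · rw [mul_assoc, mul_left_comm]
        exact R.mul_mem (R.pow_mem htR j) (hmT u hu)

theorem subset_dt {F : Type} [Field F] (D I : Set F) (hI : ∃ y ∈ I, y ≠ 0) (h0 : (0 : F) ∈ D) :
    I ⊆ dt D I := by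
  intro x hx
  by_cases hx0 : x = 0
  · obtain ⟨y, hy, hy0⟩ := hI
    refine ⟨{y}, by simpa using hy, ⟨y, by simp, hy0⟩, fun z _ => ?_⟩
    rw [hx0, zero_mul]
    exact h0
  · refine ⟨{x}, by simpa using hx, ⟨x, by simp, hx0⟩, fun z hz => ?_⟩
    rw [mul_comm]
    exact hz x (by simp)

/-- Under the conclusion of `finite_and_pow_mul_mem`, `p` is t-localizing. -/
theorem tLocalizing_of_pow_mul_mem {F : Type} [Field F] {D : Subring F} {p : Ideal ↥D}
    (hp : p.IsPrime) (hbot : p ≠ ⊥) {c : F} (hc : c ∉ primeLoc D p hp)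
    (hpow : ∀ t ∈ plocIdl D p, ∃ k : ℕ, t ^ k * c ∈ primeLoc D p hp) : TLocalizing D p := by
  refine Set.Subset.antisymm ?_ ?_
  · rintro x ⟨T, hT, -, hx⟩
    obtain ⟨m, -, hmc, hmT⟩ := exists_notMem_forall_mul_mem hc T fun t ht =>
      ⟨plocIdl_subset_primeLoc hp (hT ht), hpow t (hT ht)⟩
    have hxR : x ∈ primeLoc D p hp := by
      have := hx 1 fun t ht => by
        rw [one_mul]
        exact plocIdl_subset_primeLoc hp (hT ht)
      rwa [mul_one] at this
    by_contra hxp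
    obtain ⟨hx0, hxinv⟩ := inv_mem_primeLoc_of_notMem_plocIdl hp hxR hxp
    have h : x * (m * c) ∈ primeLoc D p hp := hx (m * c) fun t ht => by
      rw [mul_comm]
      exact hmT t ht
    refine hmc ?_
    have := (primeLoc D p hp).mul_mem hxinv h
    rwa [inv_mul_cancel_left₀ hx0] at this
  · obtain ⟨y, hy, hy0⟩ := Submodule.exists_mem_ne_zero_of_ne_bot hbot
    have h1 : (1 : ↥D) ∉ p := (Ideal.ne_top_iff_one p).1 hp.ne_top
    exact subset_dt _ _ ⟨y, ⟨y, hy, 1, h1, by simp⟩, fun h => hy0 (Subtype.ext h)⟩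
      (primeLoc D p hp).zero_mem

/-- Under the conclusion of `finite_and_pow_mul_mem`, `p` is t-maximal. -/
theorem isTMax_of_pow_mul_mem {F : Type} [Field F] {D : Subring F} {p : Ideal ↥D}
    (hp : p.IsPrime) (hmax : p.IsMaximal) (hbot : p ≠ ⊥) {c : F} (hc : c ∉ primeLoc D p hp)
    (hpow : ∀ t ∈ plocIdl D p, ∃ k : ℕ, t ^ k * c ∈ primeLoc D p hp) : IsTMax D p := by
  classical
  have h1 : (1 : ↥D) ∉ p := (Ideal.ne_top_iff_one p).1 hp.ne_top
  refine ⟨hp.ne_top, Set.Subset.antisymm ?_ ?_, fun q hq _ hpq => hmax.eq_of_le hq hpq⟩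
  · rintro x ⟨T, hT, -, hx⟩
    have hTD : ∀ t ∈ T, t ∈ D := by
      intro t ht
      obtain ⟨y, -, rfl⟩ := hT ht
      exact y.2
    have hTp : ∀ t ∈ T, t ∈ plocIdl D p := by
      intro t ht
      obtain ⟨y, hy, rfl⟩ := hT ht
      exact ⟨y, hy, 1, h1, by simp⟩
    obtain ⟨m, -, hmc, hmT⟩ := exists_notMem_forall_mul_mem hc T fun t ht =>
      ⟨le_primeLoc hp (hTD t ht), hpow t (hTp t ht)⟩
    obtain ⟨s, hs, hsT⟩ : ∃ s : ↥D, s ∉ p ∧ ∀ t ∈ T, (s : F) * (t * (m * c)) ∈ D := by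
      clear hx hT hTD hTp
      induction T using Finset.induction_on with
      | empty => exact ⟨1, h1, by simp⟩
      | insert t T ht ih =>
        obtain ⟨s, hs, hsT⟩ := ih fun u hu => hmT u (Finset.mem_insert_of_mem hu)
        obtain ⟨b, r, hr, hb⟩ := hmT t (Finset.mem_insert_self t T)
        refine ⟨r * s, fun h => (hp.mem_or_mem h).elim hr hs, fun u hu => ?_⟩
        rw [Subring.coe_mul]
        rcases Finset.mem_insert.1 hu with rfl | hu
        · rw [mul_right_comm, hb]
          exact D.mul_mem b.2 s.2
        · rw [mul_assoc]
          exact D.mul_mem r.2 (hsT u hu)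
    have hxD : x ∈ D := by
      have := hx 1 fun t ht => by
        rw [one_mul]
        exact hTD t ht
      rwa [mul_one] at this
    refine ⟨⟨x, hxD⟩, ?_, rfl⟩
    by_contra hxp
    have h : x * ((s : F) * (m * c)) ∈ D := hx _ fun t ht => by
      rw [mul_assoc, mul_comm (m * c) t]
      exact hsT t ht
    refine hmc (mem_primeLoc_of_mul_mem hp
      (fun h' => (hp.mem_or_mem h').elim hxp hs : ⟨x, hxD⟩ * s ∉ p) ?_)
    rw [Subring.coe_mul, mul_assoc]
    exact h
  · obtain ⟨y, hy, hy0⟩ := Submodule.exists_mem_ne_zero_of_ne_bot hbot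
    exact subset_dt _ _ ⟨y, ⟨y, hy, rfl⟩, fun h => hy0 (Subtype.ext h)⟩ D.zero_mem

/-- If `Int(D) ⊆ D_p[X]`, then `Int(D)_p = D_p[X]`. -/
theorem coe_plocIntSubmodule_eq_polySet {F : Type} [Field F] {D : Subring F} {p : Ideal ↥D}
    (hp : p.IsPrime)
    (h : ∀ f ∈ IntR (D : Set F), ∀ n, f.coeff n ∈ primeLoc D p hp) :
    (plocIntSubmodule D p hp : Set F[X]) = polySet (primeLoc D p hp : Set F) := by
  refine Set.Subset.antisymm ?_ ?_
  · rintro f ⟨g, hg, s, hs, hfg⟩ n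
    have hn := (primeLoc D p hp).mul_mem (inv_mem_primeLoc hp hs) (h g hg n)
    rwa [← hfg, coeff_C_mul, inv_mul_cancel_left₀ (ne_zero_of_notMem hs)] at hn
  · intro f hf
    rw [SetLike.mem_coe, f.as_sum_range]
    refine Submodule.sum_mem _ fun i _ => ?_
    have hi : monomial i (f.coeff i) =
        (⟨f.coeff i, hf i⟩ : ↥(primeLoc D p hp)) • (X ^ i : F[X]) := by
      rw [Subring.smul_def, smul_X_eq_monomial]
    rw [hi]
    refine Submodule.smul_mem _ _ ⟨X ^ i, fun x hx => ?_, 1,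
      (Ideal.ne_top_iff_one p).1 hp.ne_top, by simp⟩
    rw [eval_pow, eval_X]
    exact D.pow_mem hx i

/-- If `pD_p` is principal and `p ≠ 0`, then `D_p` has a nonzero nonunit dividing every
nonunit. -/
theorem exists_uniformizer_of_pLocPrincipal {F : Type} [Field F] {D : Subring F} {p : Ideal ↥D}
    (hp : p.IsPrime) (hbot : p ≠ ⊥) (h : PLocPrincipal D p) :
    ∃ π : ↥(primeLoc D p hp), π ≠ 0 ∧ ¬ IsUnit π ∧ ∀ x, IsUnit x ∨ π ∣ x := by
  obtain ⟨g, hg⟩ := h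
  have hgm : g ∈ plocIdl D p := by
    rw [hg]
    exact ⟨1, (primeLoc D p hp).one_mem, (one_mul g).symm⟩
  have hg0 : g ≠ 0 := by
    rintro rfl
    obtain ⟨y, hy, hy0⟩ := Submodule.exists_mem_ne_zero_of_ne_bot hbot
    have hy' : (y : F) ∈ plocIdl D p :=
      ⟨y, hy, 1, (Ideal.ne_top_iff_one p).1 hp.ne_top, by simp⟩
    rw [hg] at hy'
    obtain ⟨d, -, hd⟩ := hy'
    exact hy0 (Subtype.ext (by rw [hd, mul_zero]; rfl))
  refine ⟨⟨g, plocIdl_subset_primeLoc hp hgm⟩, fun h => hg0 (congrArg Subtype.val h), ?_, ?_⟩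
  · intro hu
    obtain ⟨b, hb⟩ := hu.exists_right_inv
    have hb' : g * (b : F) = 1 := congrArg Subtype.val hb
    refine inv_notMem_primeLoc_of_mem_plocIdl hp hgm hg0 ?_
    rw [← eq_inv_of_mul_eq_one_right hb']
    exact b.2
  · rintro ⟨x, hx⟩
    by_cases hxp : x ∈ plocIdl D p
    · right
      rw [hg] at hxp
      obtain ⟨d, hd, rfl⟩ := hxp
      exact ⟨⟨d, hd⟩, Subtype.ext (mul_comm d g)⟩
    · left
      obtain ⟨hx0, hxinv⟩ := inv_mem_primeLoc_of_notMem_plocIdl hp hx hxp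
      exact IsUnit.of_mul_eq_one ⟨x⁻¹, hxinv⟩ (Subtype.ext (mul_inv_cancel₀ hx0))

/-- If `pD_p` is principal and `Int(D_p) = Int(D)_p` for every
t-localizing t-maximal ideal `p` of `D` with finite residue field, then `Int(D)` is
locally free as a `D`-module: `Int(D)_p` is a free `D_p`-module for every prime `p`. -/
theorem stmt_12 (F : Type) [Field F] (D : Subring F)
    (hqf : IsQuotField D) (hne : (↑D : Set F) ≠ Set.univ)
    (hyp : ∀ p : Ideal ↥D, IsTMax D p → TLocalizing D p → Finite (↥D ⧸ p) →
      PLocPrincipal D p ∧ IntR (plocSet D p) = plocPoly D p (IntR (↑D : Set F))) :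
    ∀ p : Ideal ↥D, ∀ hp : p.IsPrime,
      Module.Free ↥(primeLoc D p hp) ↥(plocIntSubmodule D p hp) := by
  intro p hp
  by_cases hcoeff : ∀ f ∈ IntR (D : Set F), ∀ n, f.coeff n ∈ primeLoc D p hp
  · exact free_of_coe_eq_polySet _ (coe_plocIntSubmodule_eq_polySet hp hcoeff)
  · push Not at hcoeff
    obtain ⟨f, hf, n, hc⟩ := hcoeff
    obtain ⟨hfin, hpow⟩ := finite_and_pow_mul_mem hp hf hc
    have hbot : p ≠ ⊥ := by
      rintro rfl
      obtain ⟨a, b, hb, hab⟩ := hqf (f.coeff n)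
      exact hc ⟨a, b, fun h => hb (Ideal.mem_bot.1 h), hab⟩
    have hmax : p.IsMaximal := Ideal.Quotient.maximal_of_isField p (Finite.isField_of_domain _)
    obtain ⟨hprin, hint⟩ := hyp p (isTMax_of_pow_mul_mem hp hmax hbot hc hpow)
      (tLocalizing_of_pow_mul_mem hp hbot hc hpow) hfin
    obtain ⟨π, h0, hnu, hloc⟩ := exists_uniformizer_of_pLocPrincipal hp hbot hprin
    exact free_of_coe_eq_intR π h0 hnu hloc _ hint.symm
end

section
/- Let D be an integral domain with quotient field K ≠ D, and suppose there is a nonzero finitely generated ideal I of D such that D' = I⁻¹ = (D :_K I) is a subring of K. If Int(D) is flat as a D-module, then Int(D,D') = D'·Int(D). -/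
open IVP Polynomial

namespace IVP

variable {F : Type} [Field F]

theorem subset_dinv_iset (D : Subring F) (I : Ideal ↥D) :
    (↑D : Set F) ⊆ dinv ↑D (iset D ↑I) := by
  rintro x hx _ ⟨d, -, rfl⟩
  exact D.mul_mem hx d.2

theorem span_IntR_subset_IntOn {D D' : Subring F} (h : D ≤ D') :
    (Submodule.span ↥D' (IntR (↑D : Set F)) : Set (Polynomial F)) ⊆ IntOn (↑D) (↑D') := by
  intro f hf x hx
  induction hf using Submodule.span_induction with
  | mem g hg => exact h (hg x hx)
  | zero => simp
  | add g g' _ _ hg hg' => rw [eval_add]; exact D'.add_mem hg hg'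
  | smul c g _ hg =>
    rw [Subring.smul_def, eval_smul, smul_eq_mul]
    exact D'.mul_mem c.2 hg

/-- In a flat module, elements `x i` proportional to scalars `s i` factor simultaneously through
coefficients proportional to the same scalars. -/
theorem exists_proportional_coeffs_of_flat {R M ι : Type*} [CommRing R] [AddCommGroup M]
    [Module R M] [Module.Flat R M] [Finite ι] (s : ι → R) (x : ι → M) (i₀ : ι)
    (h : ∀ i, s i • x i₀ = s i₀ • x i) :
    ∃ (k : ℕ) (a : ι → Fin k → R) (y : Fin k → M),
      (∀ i, x i = ∑ j, a i j • y j) ∧ ∀ i j, s i * a i₀ j = s i₀ * a i j := by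
  have hcomp : Finsupp.linearCombination R x ∘ₗ
      Finsupp.linearCombination R (fun i =>
        Finsupp.single i₀ (s i) - Finsupp.single i (s i₀)) = 0 := by
    ext i
    simp [h i]
  obtain ⟨k, a, y, hay, ha⟩ := Module.Flat.exists_factorization_of_comp_eq_zero_of_free hcomp
  have hsingle : ∀ (i : ι) (r : R), Finsupp.single i r = r • Finsupp.single i 1 := by simp
  refine ⟨k, fun i => a (Finsupp.single i 1), fun j => y (Finsupp.single j 1),
    fun i => ?_, fun i j => ?_⟩
  · have hi : x i = y (a (Finsupp.single i 1)) := by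
      simpa using LinearMap.congr_fun hay (Finsupp.single i 1)
    rw [hi]
    conv_lhs => rw [← Finsupp.univ_sum_single (a (Finsupp.single i 1))]
    rw [map_sum]
    refine Finset.sum_congr rfl fun j _ => ?_
    rw [← map_smul, Finsupp.smul_single_one]
  · have hi := LinearMap.congr_fun ha (Finsupp.single i 1)
    simp only [LinearMap.comp_apply, Finsupp.linearCombination_single, one_smul, map_sub,
      LinearMap.zero_apply, sub_eq_zero] at hi
    rw [hsingle i₀, hsingle i, map_smul, map_smul] at hi
    simpa using DFunLike.congr_fun hi j

end IVP

/-- If `I` is a nonzero finitely generated ideal of `D` such that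
`D' = I⁻¹` is a subring of `K`, and `Int(D)` is flat as a `D`-module, then
`Int(D,D') = D'·Int(D)`. -/
theorem stmt_13 (F : Type) [Field F] (D : Subring F)
    (hqf : IsQuotField D) (hne : (↑D : Set F) ≠ Set.univ)
    (I : Ideal ↥D) (hI0 : I ≠ ⊥) (hIfg : I.FG)
    (D' : Subring F) (hD' : (↑D' : Set F) = dinv ↑D (iset D ↑I))
    (hflat : Module.Flat ↥D ↥(intSubmodule D)) :
    IntOn (↑D) (↑D') = (Submodule.span ↥D' (IntR (↑D : Set F)) : Set (Polynomial F)) := by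
  have hDD' : D ≤ D' := fun x hx => by
    have := subset_dinv_iset D I hx
    rwa [← hD'] at this
  refine Set.Subset.antisymm (fun f hf => ?_) (span_IntR_subset_IntOn hDD')
  have hmul : ∀ d ∈ I, d • f ∈ intSubmodule D := fun d hd x hx => by
    have hfx : f.eval x ∈ dinv ↑D (iset D ↑I) := hD' ▸ hf x hx
    rw [Subring.smul_def, eval_smul, smul_eq_mul, mul_comm]
    exact hfx _ ⟨d, hd, rfl⟩
  obtain ⟨S, rfl⟩ := hIfg
  obtain ⟨s₀, hs₀, hs₀0⟩ : ∃ s ∈ S, s ≠ 0 := by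
    by_contra! h
    exact hI0 (Submodule.span_eq_bot.mpr h)
  obtain ⟨k, a, y, hx, ha⟩ := exists_proportional_coeffs_of_flat
    (fun s : ↥S => (s : ↥D))
    (fun s : ↥S => (⟨(s : ↥D) • f, hmul s (Submodule.subset_span s.2)⟩ : ↥(intSubmodule D)))
    ⟨s₀, hs₀⟩ (fun s => Subtype.ext (smul_comm _ _ _))
  have hs₀F : (s₀ : F) ≠ 0 := by simpa using hs₀0
  have hc : ∀ j, (a ⟨s₀, hs₀⟩ j : F) / s₀ ∈ D' := fun j => by
    rw [← SetLike.mem_coe, hD']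
    rintro _ ⟨d, hd, rfl⟩
    induction hd using Submodule.span_induction with
    | mem s hs =>
      have hsj : (s : F) * a ⟨s₀, hs₀⟩ j = s₀ * a ⟨s, hs⟩ j :=
        congrArg Subtype.val (ha ⟨s, hs⟩ j)
      rw [div_mul_eq_mul_div, mul_comm, hsj, mul_div_cancel_left₀ _ hs₀F]
      exact (a ⟨s, hs⟩ j).2
    | zero => simp
    | add d e _ _ hd he =>
      push_cast
      rw [mul_add]
      exact D.add_mem hd he
    | smul r d _ hd =>
      rw [smul_eq_mul, Subring.coe_mul, mul_left_comm]
      exact D.mul_mem r.2 hd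
  have hf' : f = ∑ j, (⟨_, hc j⟩ : ↥D') • (y j : Polynomial F) := by
    have hx₀ : (s₀ : F) • f = ∑ j, (a ⟨s₀, hs₀⟩ j : F) • (y j : Polynomial F) := by
      simpa [Subring.smul_def] using congrArg Subtype.val (hx ⟨s₀, hs₀⟩)
    rw [← inv_smul_smul₀ hs₀F f, hx₀, Finset.smul_sum]
    refine Finset.sum_congr rfl fun j _ => ?_
    rw [Subring.smul_def, smul_smul, ← div_eq_inv_mul]
  rw [hf']
  exact Submodule.sum_mem _ fun j _ =>
    Submodule.smul_mem _ _ (Submodule.subset_span (y j).2)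
end

section
/- Let D be an integral domain with quotient field K ≠ D, and view Int(D) as a subring of the rational function field K(X) (the quotient field of Int(D)). Then for any nonzero fractional ideal I of D, (I·Int(D))⁻¹ = Int(D, I⁻¹) = (Int(D,I))⁻¹, where for a nonzero Int(D)-submodule J of K(X), J⁻¹ = {g ∈ K(X) : gJ ⊆ Int(D)}. -/
open IVP Polynomial

/-- `I` is a nonzero fractional ideal of `D`: a nonzero `D`-submodule of the quotient
field with `dI ⊆ D` for some nonzero `d ∈ D`. -/
def IsFracIdl {F : Type} [Field F] (D : Subring F) (I : Set F) : Prop :=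
  (∃ x ∈ I, x ≠ 0) ∧ (∀ x ∈ I, ∀ y ∈ I, x + y ∈ I) ∧
    (∀ d : ↥D, ∀ x ∈ I, (d : F) * x ∈ I) ∧
    ∃ d : ↥D, d ≠ 0 ∧ ∀ x ∈ I, (d : F) * x ∈ D

/-- `Int(D)` viewed as a subring of the rational function field `K(X)`, the quotient
field of `Int(D)`. -/
noncomputable def IntQ {F : Type} [Field F] (D : Subring F) : Subring (RatFunc F) :=
  (IntSubring D).map (algebraMap (Polynomial F) (RatFunc F))

/-- The inverse `J⁻¹ = {g ∈ K(X) : gJ ⊆ Int(D)}` of a subset `J` of `K(X)` with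
respect to `Int(D)`. -/
def qinv {F : Type} [Field F] (D : Subring F) (J : Set (RatFunc F)) : Set (RatFunc F) :=
  {g | ∀ h ∈ J, g * h ∈ IntQ D}

lemma mem_IntQ_algebraMap {F : Type} [Field F] (D : Subring F) (f : Polynomial F) :
    algebraMap (Polynomial F) (RatFunc F) f ∈ IntQ D ↔ f ∈ IntR (D : Set F) := by
  constructor
  · rintro ⟨g, hg, hgf⟩
    rwa [← RatFunc.algebraMap_injective F hgf]
  · exact fun hf => ⟨f, hf, rfl⟩

lemma qinv_span {F : Type} [Field F] (D : Subring F) (J : Set (RatFunc F)) :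
    qinv D (Submodule.span ↥(IntQ D) J : Set (RatFunc F)) = qinv D J := by
  refine Set.Subset.antisymm (fun g hg h hh => hg h (Submodule.subset_span hh)) ?_
  intro g hg h hh
  induction hh using Submodule.span_induction with
  | mem x hx => exact hg x hx
  | zero => simp
  | add x y _ _ hx hy => simpa [mul_add] using (IntQ D).add_mem hx hy
  | smul a x _ hx =>
    rw [Subring.smul_def, smul_eq_mul, mul_left_comm]
    exact (IntQ D).mul_mem a.2 hx

/-- The inverse of a set of constants, not all zero, consists of the polynomials with values in
the inverse of that set. -/
lemma qinv_image_algebraMap {F : Type} [Field F] (D : Subring F) (I : Set F)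
    (hI : ∃ x ∈ I, x ≠ 0) :
    qinv D (algebraMap F (RatFunc F) '' I) =
      algebraMap (Polynomial F) (RatFunc F) '' IntOn (↑D) (dinv ↑D I) := by
  have hC (y : F) : algebraMap F (RatFunc F) y =
      algebraMap (Polynomial F) (RatFunc F) (C y) := by
    rw [RatFunc.algebraMap_C, RatFunc.algebraMap_eq_C]
  ext g
  constructor
  · intro hg
    obtain ⟨x, hx, hx0⟩ := hI
    obtain ⟨f, -, hf⟩ := hg _ ⟨x, hx, rfl⟩
    have hgf : g = algebraMap (Polynomial F) (RatFunc F) (f * C x⁻¹) := by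
      rw [map_mul, hf, mul_assoc, ← hC, ← map_mul, mul_inv_cancel₀ hx0, map_one, mul_one]
    refine ⟨f * C x⁻¹, fun d hd y hy => ?_, hgf.symm⟩
    have hy' := hg _ ⟨y, hy, rfl⟩
    rw [hgf, hC, ← map_mul, mem_IntQ_algebraMap] at hy'
    simpa using hy' d hd
  · rintro ⟨f, hf, rfl⟩ _ ⟨y, hy, rfl⟩
    rw [hC, ← map_mul, mem_IntQ_algebraMap]
    intro d hd
    simpa using hf d hd y hy

/-- `(I·Int(D))⁻¹ = Int(D, I⁻¹) = (Int(D,I))⁻¹` for any nonzero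
fractional ideal `I` of `D`, computed inside `K(X)`. -/
theorem stmt_15 (F : Type) [Field F] (D : Subring F)
    (hqf : IsQuotField D) (hne : (↑D : Set F) ≠ Set.univ)
    (I : Set F) (hI : IsFracIdl D I) :
    qinv D (Submodule.span ↥(IntQ D) ((algebraMap F (RatFunc F)) '' I) :
        Set (RatFunc F)) =
      (algebraMap (Polynomial F) (RatFunc F)) '' IntOn (↑D) (dinv ↑D I) ∧
    (algebraMap (Polynomial F) (RatFunc F)) '' IntOn (↑D) (dinv ↑D I) =
      qinv D ((algebraMap (Polynomial F) (RatFunc F)) '' IntOn (↑D) I) := by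
  refine ⟨by rw [qinv_span, qinv_image_algebraMap D I hI.1], Set.Subset.antisymm ?_ ?_⟩
  · rintro _ ⟨f, hf, rfl⟩ _ ⟨h, hh, rfl⟩
    rw [← map_mul, mem_IntQ_algebraMap]
    intro d hd
    rw [eval_mul]
    exact hf d hd _ (hh d hd)
  · rw [← qinv_image_algebraMap D I hI.1]
    rintro g hg _ ⟨y, hy, rfl⟩
    refine hg _ ⟨C y, fun d _ => by simpa using hy, ?_⟩
    rw [RatFunc.algebraMap_C, RatFunc.algebraMap_eq_C]
end

section
/- Let D be an integral domain with quotient field K ≠ D. Then D is polynomially F-regular (every flat extension of D is polynomially regular) if and only if D is polynomially L-regular (Int(S⁻¹D) = S⁻¹Int(D) for every multiplicative subset S of D with 0 ∉ S) and D_p is polynomially F-regular for every t-localizing t-maximal ideal p of D with D/p finite. -/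
open IVP Polynomial

namespace IVP

variable {F L : Type} [Field F] [Field L]

/-- The localization of `A ⊇ D` at a multiplicative subset of `D`, as a subring of `L`. -/
def locExt (D : Subring F) (φ : F →+* L) (A : Subring L) (h : ExtMem D φ A)
    (S : Submonoid ↥D) : Subring L where
  carrier := {x | ∃ s ∈ S, φ (s : F) * x ∈ A}
  one_mem' := ⟨1, S.one_mem, by simp⟩
  zero_mem' := ⟨1, S.one_mem, by simp⟩
  mul_mem' := by
    rintro x y ⟨s, hs, hx⟩ ⟨t, ht, hy⟩
    refine ⟨s * t, S.mul_mem hs ht, ?_⟩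
    have := A.mul_mem hx hy
    rw [mul_mul_mul_comm] at this
    simpa using this
  add_mem' := by
    rintro x y ⟨s, hs, hx⟩ ⟨t, ht, hy⟩
    refine ⟨s * t, S.mul_mem hs ht, ?_⟩
    have := A.add_mem (A.mul_mem (h t) hx) (A.mul_mem (h s) hy)
    convert this using 1
    push_cast
    rw [map_mul]
    ring
  neg_mem' := by
    rintro x ⟨s, hs, hx⟩
    exact ⟨s, hs, by rw [mul_neg]; exact A.neg_mem hx⟩

theorem mem_locExt {D : Subring F} {φ : F →+* L} {A : Subring L} {h : ExtMem D φ A}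
    {S : Submonoid ↥D} {x : L} : x ∈ locExt D φ A h S ↔ ∃ s ∈ S, φ (s : F) * x ∈ A :=
  Iff.rfl

theorem le_locExt {D : Subring F} {φ : F →+* L} {A : Subring L} {h : ExtMem D φ A}
    {S : Submonoid ↥D} : A ≤ locExt D φ A h S :=
  fun x hx => ⟨1, S.one_mem, by simpa using hx⟩

theorem mem_locExt_of_mul_mem {D : Subring F} {φ : F →+* L} {A : Subring L} {h : ExtMem D φ A}
    {S : Submonoid ↥D} {s : ↥D} (hs : s ∈ S) {x : L}
    (hx : φ (s : F) * x ∈ locExt D φ A h S) : x ∈ locExt D φ A h S := by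
  obtain ⟨t, ht, htx⟩ := hx
  exact ⟨t * s, S.mul_mem ht hs, by simpa [mul_assoc] using htx⟩

theorem mem_mlocSet {D : Subring F} {S : Set ↥D} {x : F} :
    x ∈ mlocSet D S ↔ ∃ s ∈ S, (s : F) * x ∈ D :=
  ⟨fun ⟨a, s, hs, h⟩ => ⟨s, hs, h ▸ a.2⟩, fun ⟨s, hs, h⟩ => ⟨⟨_, h⟩, s, hs, rfl⟩⟩

/-- A polynomial that is integer-valued on `D`, with values in a ring where the elements of `S`
are invertible, is integer-valued on `S⁻¹D`. -/
theorem eval_mem_of_mem_mlocSet {D : Subring F} {φ : F →+* L} {B : Subring L} {S : Submonoid ↥D}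
    (hD : ExtMem D φ B) (hinv : ∀ s ∈ S, ∀ x : L, φ (s : F) * x ∈ B → x ∈ B)
    {f : L[X]} (hf : f ∈ IntOn (φ '' ↑D) ↑B) {x : F} (hx : x ∈ mlocSet D ↑S) :
    f.eval (φ x) ∈ B := by
  obtain ⟨a, s, hs, hsx⟩ := hx
  have key : ∀ n : ℕ, ∀ f : L[X], (∀ m, n ≤ m → f.coeff m = 0) → f ∈ IntOn (φ '' ↑D) ↑B →
      f.eval (φ x) ∈ B := by
    intro n
    induction n with
    | zero =>
      intro f hn _
      have : f = 0 := by ext m; simpa using hn m (Nat.zero_le m)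
      simp [this]
    | succ n ih =>
      intro f hn hf
      have hg := ih (C (φ (s : F) ^ n) * f - f.comp (C (φ (s : F)) * X)) (fun m hm => by
        rw [coeff_sub, coeff_C_mul, comp_C_mul_X_coeff]
        rcases hm.eq_or_lt with rfl | hm
        · ring
        · simp [hn m hm]) (by
        rintro _ ⟨d, hd, rfl⟩
        have h1 : f.eval (φ d) ∈ B := hf _ ⟨d, hd, rfl⟩
        have h2 : f.eval (φ ((s : F) * d)) ∈ B := hf _ ⟨_, D.mul_mem s.2 hd, rfl⟩
        have h3 := B.sub_mem (B.mul_mem (B.pow_mem (hD s) n) h1) h2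
        simpa using h3)
      have h2 : f.eval (φ (a : F)) ∈ B := hf _ ⟨a, a.2, rfl⟩
      have h3 : φ (s : F) ^ n * f.eval (φ x) ∈ B := by
        have := B.add_mem hg h2
        simpa [← hsx] using this
      have h4 := hinv (s ^ n) (S.pow_mem hs n) (f.eval (φ x))
      exact h4 (by simpa using h3)
  exact key (f.natDegree + 1) f (fun m hm => coeff_eq_zero_of_natDegree_lt hm) hf

theorem span_subset_intOn {D : Subring F} {φ : F →+* L} {A : Subring L} (h : ExtMem D φ A) :
    (↑(Submodule.span ↥A (Polynomial.map φ '' IntR (↑D : Set F))) : Set L[X]) ⊆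
      IntOn (φ '' ↑D) ↑A := by
  intro f hf
  induction hf using Submodule.span_induction with
  | mem f hf =>
    obtain ⟨g, hg, rfl⟩ := hf
    rintro _ ⟨d, hd, rfl⟩
    rw [eval_map_apply]
    exact h ⟨_, hg d hd⟩
  | zero => intro x _; simp
  | add f g _ _ hf hg =>
    intro x hx
    rw [eval_add]
    exact A.add_mem (hf x hx) (hg x hx)
  | smul a f _ hf =>
    intro x hx
    rw [Subring.smul_def, eval_smul, smul_eq_mul]
    exact A.mul_mem a.2 (hf x hx)

theorem C_mul_mem_span {A : Subring L} {T : Set L[X]} {a : L} (ha : a ∈ A) {f : L[X]}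
    (hf : f ∈ Submodule.span ↥A T) : C a * f ∈ Submodule.span ↥A T := by
  have := Submodule.smul_mem _ (⟨a, ha⟩ : ↥A) hf
  rwa [Subring.smul_def, smul_eq_C_mul] at this

theorem exists_C_mul_mem_span {D : Subring F} {φ : F →+* L} {A B : Subring L}
    (h : ExtMem D φ A) {S : Submonoid ↥D} (hB : ∀ b ∈ B, ∃ s ∈ S, φ (s : F) * b ∈ A)
    {T U : Set F[X]} (hT : ∀ t ∈ T, ∃ s ∈ S, C (s : F) * t ∈ U) {f : L[X]}
    (hf : f ∈ Submodule.span ↥B (Polynomial.map φ '' T)) :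
    ∃ s ∈ S, C (φ (s : F)) * f ∈ Submodule.span ↥A (Polynomial.map φ '' U) := by
  induction hf using Submodule.span_induction with
  | mem f hf =>
    obtain ⟨t, ht, rfl⟩ := hf
    obtain ⟨s, hs, hst⟩ := hT t ht
    exact ⟨s, hs, Submodule.subset_span ⟨_, hst, by simp⟩⟩
  | zero => exact ⟨1, S.one_mem, by simp⟩
  | add f g _ _ hf hg =>
    obtain ⟨s, hs, hsf⟩ := hf
    obtain ⟨t, ht, htg⟩ := hg
    refine ⟨s * t, S.mul_mem hs ht, ?_⟩
    convert Submodule.add_mem _ (C_mul_mem_span (h t) hsf) (C_mul_mem_span (h s) htg) using 1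
    push_cast
    rw [map_mul, map_mul]
    ring
  | smul b f _ hf =>
    obtain ⟨s, hs, hsf⟩ := hf
    obtain ⟨t, ht, htb⟩ := hB b b.2
    refine ⟨t * s, S.mul_mem ht hs, ?_⟩
    convert C_mul_mem_span htb hsf using 1
    rw [Subring.smul_def, smul_eq_C_mul]
    push_cast
    rw [map_mul, map_mul, map_mul]
    ring

theorem isLocalization_inclusion {D R : Subring F} (hDR : D ≤ R) {S : Submonoid ↥D}
    (h0 : (0 : ↥D) ∉ S) (hR : ∀ x, x ∈ R ↔ ∃ s ∈ S, (s : F) * x ∈ D) :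
    letI := (Subring.inclusion hDR).toAlgebra
    IsLocalization S ↥R := by
  let := (Subring.inclusion hDR).toAlgebra
  have hne : ∀ s ∈ S, (s : F) ≠ 0 := fun s hs h => h0 (by
    have : s = 0 := Subtype.ext h
    rwa [this] at hs)
  refine (isLocalization_iff S ↥R).2 ⟨?_, ?_, ?_⟩
  · rintro ⟨s, hs⟩
    have hmem : (s : F)⁻¹ ∈ R := (hR _).2 ⟨s, hs, by
      rw [mul_inv_cancel₀ (hne s hs)]; exact D.one_mem⟩
    exact IsUnit.of_mul_eq_one ⟨_, hmem⟩ (Subtype.ext (mul_inv_cancel₀ (hne s hs)))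
  · rintro ⟨z, hz⟩
    obtain ⟨s, hs, hsz⟩ := (hR z).1 hz
    exact ⟨(⟨_, hsz⟩, ⟨s, hs⟩), Subtype.ext (mul_comm _ _)⟩
  · intro x y hxy
    exact ⟨1, by rw [Subring.inclusion_injective hDR hxy]⟩

theorem extFlat_of_isLocalization {D R : Subring F} (hDR : D ≤ R) {S : Submonoid ↥D}
    (h0 : (0 : ↥D) ∉ S) (hR : ∀ x, x ∈ R ↔ ∃ s ∈ S, (s : F) * x ∈ D) :
    ExtFlat D (RingHom.id F) R (fun d => hDR d.2) := by
  let := (Subring.inclusion hDR).toAlgebra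
  have := isLocalization_inclusion hDR h0 hR
  exact IsLocalization.flat ↥R S

theorem ExtFlat.of_isLocalization {D R : Subring F} (hDR : D ≤ R) {S : Submonoid ↥D}
    (h0 : (0 : ↥D) ∉ S) (hR : ∀ x, x ∈ R ↔ ∃ s ∈ S, (s : F) * x ∈ D)
    {φ : F →+* L} {A : Subring L} {h : ExtMem R φ A} (hA : ExtFlat R φ A h) :
    ExtFlat D φ A (fun d => h ⟨d, hDR d.2⟩) := by
  let := (Subring.inclusion hDR).toAlgebra
  have := isLocalization_inclusion hDR h0 hR
  let : Module ↥R ↥A := Module.compHom ↥A (extHom R φ A h)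
  let : Module ↥D ↥A := Module.compHom ↥A (extHom D φ A (fun d => h ⟨d, hDR d.2⟩))
  have : IsScalarTower ↥D ↥R ↥A := ⟨fun d r a => by
    apply Subtype.ext
    change φ ((d : F) * r) * a = φ d * (φ r * a)
    rw [map_mul, mul_assoc]⟩
  have : Module.Flat ↥R ↥A := hA
  have : Module.Flat ↥D ↥R := IsLocalization.flat ↥R S
  exact Module.Flat.trans ↥D ↥R ↥A

theorem ExtFlat.localize {D R : Subring F} (hDR : D ≤ R) {S : Submonoid ↥D}
    (h0 : (0 : ↥D) ∉ S) (hR : ∀ x, x ∈ R ↔ ∃ s ∈ S, (s : F) * x ∈ D)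
    {φ : F →+* L} {A : Subring L} {h : ExtMem D φ A} (hA : ExtFlat D φ A h)
    (h' : ExtMem R φ (locExt D φ A h S)) :
    ExtFlat R φ (locExt D φ A h S) h' := by
  let := (Subring.inclusion hDR).toAlgebra
  have := isLocalization_inclusion hDR h0 hR
  let : Module ↥R ↥(locExt D φ A h S) := Module.compHom _ (extHom R φ _ h')
  let : Module ↥D ↥(locExt D φ A h S) :=
    Module.compHom _ (extHom D φ _ (fun d => le_locExt (h := h) (S := S) (h d)))
  let : Module ↥D ↥A := Module.compHom ↥A (extHom D φ A h)
  have : Module.Flat ↥D ↥A := hA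
  have : IsScalarTower ↥D ↥R ↥(locExt D φ A h S) := ⟨fun d r a => by
    apply Subtype.ext
    change φ ((d : F) * r) * a = φ d * (φ r * a)
    rw [map_mul, mul_assoc]⟩
  have hne : ∀ s ∈ S, φ (s : F) ≠ 0 := fun s hs hs0 => h0 (by
    have : s = 0 := Subtype.ext ((map_eq_zero φ).1 hs0)
    rwa [this] at hs)
  let ι : ↥A →ₗ[↥D] ↥(locExt D φ A h S) :=
    { toFun := fun a => ⟨a, le_locExt a.2⟩
      map_add' := fun _ _ => rfl
      map_smul' := fun _ _ => rfl }
  have : IsLocalizedModule S ι :=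
    { map_units := fun s => by
        refine (Module.End.isUnit_iff _).2 ⟨?_, ?_⟩
        · intro x y hxy
          have hxy' : φ ((s : ↥D) : F) * (x : L) = φ ((s : ↥D) : F) * y :=
            congrArg Subtype.val hxy
          exact Subtype.ext (mul_left_cancel₀ (hne s s.2) hxy')
        · intro y
          have hy : φ ((s : ↥D) : F) * ((φ ((s : ↥D) : F))⁻¹ * (y : L)) = y :=
            mul_inv_cancel_left₀ (hne s s.2) _
          exact ⟨⟨(φ ((s : ↥D) : F))⁻¹ * y, mem_locExt_of_mul_mem s.2 (by rw [hy]; exact y.2)⟩,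
            Subtype.ext hy⟩
      surj := by
        rintro ⟨y, s, hs, hy⟩
        exact ⟨(⟨_, hy⟩, ⟨s, hs⟩), rfl⟩
      exists_of_eq := fun {x y} hxy => ⟨1, by
        have : x = y :=
          Subtype.ext (congrArg (fun z : ↥(locExt D φ A h S) => (z : L)) hxy)
        rw [this]⟩ }
  exact Module.Flat.of_isLocalizedModule ↥R S ι

theorem det_vandermonde_mul_coeff_mem {D : Subring F} {φ : F →+* L} {A : Subring L}
    (h : ExtMem D φ A) {n : ℕ} (d : Fin n → ↥D) {f : L[X]} (hn : f.natDegree < n)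
    (hf : f ∈ IntOn (φ '' ↑D) ↑A) (k : ℕ) :
    φ ((Matrix.vandermonde d).det : F) * f.coeff k ∈ A := by
  rcases lt_or_ge k n with hk | hk
  swap
  · rw [coeff_eq_zero_of_natDegree_lt (hn.trans_le hk), mul_zero]
    exact A.zero_mem
  let ψ : ↥D →+* L := φ.comp D.subtype
  have heval : (ψ.mapMatrix (Matrix.vandermonde d)).mulVec (fun i : Fin n => f.coeff i) =
      fun i => f.eval (ψ (d i)) := by
    funext i
    rw [eval_eq_sum_range' hn, ← Fin.sum_univ_eq_sum_range (fun j => f.coeff j * ψ (d i) ^ j)]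
    simp [Matrix.mulVec, dotProduct, Matrix.vandermonde_apply, mul_comm]
  have hadj := congrArg (fun v => (ψ.mapMatrix (Matrix.vandermonde d)).adjugate.mulVec v ⟨k, hk⟩)
    heval
  simp only [Matrix.mulVec_mulVec, Matrix.adjugate_mul, Matrix.smul_mulVec, Matrix.one_mulVec,
    Pi.smul_apply, smul_eq_mul] at hadj
  simp only [← RingHom.map_det, ← RingHom.map_adjugate] at hadj
  change ψ (Matrix.vandermonde d).det * f.coeff k ∈ A
  rw [hadj]
  change ∑ i, φ ((Matrix.vandermonde d).adjugate ⟨k, hk⟩ i : F) * f.eval (φ (d i : F)) ∈ A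
  exact A.sum_mem fun i _ => A.mul_mem (h _) (hf _ ⟨_, (d i).2, rfl⟩)

theorem exists_det_vandermonde_pow {R : Type*} [CommRing R] {p : Ideal R} (hp : p.IsPrime)
    {t : R} (ht : t ∈ p) (n : ℕ) :
    ∃ N : ℕ, ∃ u ∉ p, (Matrix.vandermonde fun i : Fin n => t ^ (i : ℕ)).det = t ^ N * u := by
  have h1 : (1 : R) ∉ p := fun h => hp.ne_top ((Ideal.eq_top_iff_one p).2 h)
  have hmul : ∀ a b : R, (∃ N : ℕ, ∃ u ∉ p, a = t ^ N * u) → (∃ N : ℕ, ∃ u ∉ p, b = t ^ N * u) →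
      ∃ N : ℕ, ∃ u ∉ p, a * b = t ^ N * u := by
    rintro _ _ ⟨N, u, hu, rfl⟩ ⟨M, v, hv, rfl⟩
    exact ⟨N + M, u * v, fun h => (hp.mem_or_mem h).elim hu hv, by ring⟩
  have hone : ∃ N : ℕ, ∃ u ∉ p, (1 : R) = t ^ N * u := ⟨0, 1, h1, by simp⟩
  rw [Matrix.det_vandermonde]
  refine Finset.prod_induction _ (fun a => ∃ N : ℕ, ∃ u ∉ p, a = t ^ N * u) hmul hone ?_
  intro i _
  refine Finset.prod_induction _ (fun a => ∃ N : ℕ, ∃ u ∉ p, a = t ^ N * u) hmul hone ?_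
  intro j hj
  have hij : (i : ℕ) < j := Fin.lt_def.1 (Finset.mem_Ioi.1 hj)
  refine ⟨i, t ^ ((j : ℕ) - i) - 1, fun h => h1 ?_, ?_⟩
  · have := p.sub_mem (Ideal.pow_mem_of_mem p ht _ (Nat.sub_pos_of_lt hij)) h
    simpa using this
  · rw [mul_sub, ← pow_add, Nat.add_sub_cancel' hij.le, mul_one]

theorem exists_det_vandermonde_notMem {R : Type*} [CommRing R] {p : Ideal R} (hp : p.IsPrime)
    [Infinite (R ⧸ p)] (n : ℕ) :
    ∃ d : Fin n → R, (Matrix.vandermonde d).det ∉ p := by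
  choose d hd using fun i : Fin n =>
    Ideal.Quotient.mk_surjective (Infinite.natEmbedding (R ⧸ p) (i : ℕ))
  refine ⟨d, fun h => ?_⟩
  rw [Matrix.det_vandermonde, hp.prod_mem_iff] at h
  obtain ⟨i, _, h⟩ := h
  rw [hp.prod_mem_iff] at h
  obtain ⟨j, hj, h⟩ := h
  rw [← Ideal.Quotient.eq, hd, hd] at h
  exact (Finset.mem_Ioi.1 hj).ne' (Fin.ext ((Infinite.natEmbedding (R ⧸ p)).injective h))

theorem mem_of_forall_pow_mul_mem {M ι : Type*} [CommMonoid M] [Fintype ι] {u : ι → M} {B : Set M}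
    (hmul : ∀ i, ∀ c ∈ B, u i * c ∈ B) (hB : ∀ c, (∀ i, u i * c ∈ B) → c ∈ B) (N : ι → ℕ) {c : M}
    (hc : ∀ i, u i ^ N i * c ∈ B) : c ∈ B := by
  classical
  induction hn : ∑ i, N i using Nat.strong_induction_on generalizing N c with
  | _ n ih =>
    by_cases h0 : ∃ i, N i = 0
    · obtain ⟨i, hi⟩ := h0
      simpa [hi] using hc i
    push Not at h0
    refine hB c fun i => ?_
    refine ih (∑ j, Function.update N i (N i - 1) j) ?_ (Function.update N i (N i - 1)) ?_ rfl
    · rw [← hn]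
      refine Finset.sum_lt_sum (fun j _ => ?_) ⟨i, Finset.mem_univ i, ?_⟩
      · by_cases hj : j = i
        · subst hj; simp
        · simp [hj]
      · have := h0 i
        simp only [Function.update_self]
        omega
    · intro j
      by_cases hj : j = i
      · subst hj
        rw [Function.update_self, ← mul_assoc, ← pow_succ, Nat.sub_add_cancel
          (Nat.one_le_iff_ne_zero.2 (h0 j))]
        exact hc j
      · rw [Function.update_of_ne hj]
        rw [mul_left_comm]
        exact hmul i _ (hc j)

theorem map_mem_locExt {D : Subring F} {φ : F →+* L} {A : Subring L} (h : ExtMem D φ A)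
    {S : Submonoid ↥D} {y : F} (hy : y ∈ mlocSet D ↑S) : φ y ∈ locExt D φ A h S := by
  obtain ⟨s, hs, hsy⟩ := mem_mlocSet.1 hy
  exact ⟨s, hs, by rw [← map_mul]; exact h ⟨_, hsy⟩⟩

theorem mem_locExt_of_forall_mul_mem {D : Subring F} {φ : F →+* L} {A : Subring L}
    {h : ExtMem D φ A} (hA : ExtFlat D φ A h) {S : Submonoid ↥D} {ι : Type} [Fintype ι]
    {t : ι → ↥D} (ht : ∃ i, t i ≠ 0)
    (hJ : ∀ y : F, (∀ i, (t i : F) * y ∈ mlocSet D ↑S) → y ∈ mlocSet D ↑S) {c : L}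
    (hc : ∀ i, φ (t i : F) * c ∈ A) : c ∈ locExt D φ A h S := by
  classical
  obtain ⟨i₀, hi₀⟩ := ht
  let _ : Module ↥D ↥A := Module.compHom ↥A (extHom D φ A h)
  have _ : Module.Flat ↥D ↥A := hA
  have hsmul : ∀ (d : ↥D) (a : ↥A), ((d • a : ↥A) : L) = φ d * a := fun _ _ => rfl
  let x : (ι → ↥D) →ₗ[↥D] ↥A := Fintype.linearCombination ↥D fun i => ⟨_, hc i⟩
  have hx : ∀ i, ((x (Pi.single i 1) : ↥A) : L) = φ (t i : F) * c := fun i => by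
    simp [x, Fintype.linearCombination_apply_single]
  let r : (ι × ι → ↥D) →ₗ[↥D] (ι → ↥D) := Fintype.linearCombination ↥D fun ij =>
    t ij.2 • Pi.single ij.1 1 - t ij.1 • Pi.single ij.2 1
  have hr : ∀ i j, r (Pi.single (i, j) 1) = t j • Pi.single i 1 - t i • Pi.single j 1 :=
    fun i j => by simp only [r, Fintype.linearCombination_apply_single, one_smul]
  have hxr : x ∘ₗ r = 0 := by
    refine LinearMap.pi_ext' fun ij => LinearMap.ext_ring ?_
    obtain ⟨i, j⟩ := ij
    apply Subtype.ext
    simp only [LinearMap.comp_apply, LinearMap.single_apply, hr, map_sub, map_smul,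
      AddSubgroupClass.coe_sub, hsmul, hx, LinearMap.zero_apply, ZeroMemClass.coe_zero]
    ring
  obtain ⟨k, a, y, hxy, har⟩ := Module.Flat.exists_factorization_of_comp_eq_zero_of_free hxr
  have hrel : ∀ i j l,
      (t j : F) * (a (Pi.single i 1) l : ↥D) = t i * (a (Pi.single j 1) l : ↥D) := by
    intro i j l
    have := congrArg (fun v : Fin k →₀ ↥D => ((v l : ↥D) : F))
      (LinearMap.congr_fun har (Pi.single (i, j) 1))
    simpa [hr, sub_eq_zero] using this
  have hi₀F : (t i₀ : F) ≠ 0 := fun h0 => hi₀ (Subtype.ext h0)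
  have hy : ∀ l, (a (Pi.single i₀ 1) l : F) / t i₀ ∈ mlocSet D ↑S := fun l => hJ _ fun i => by
    have : (t i : F) * ((a (Pi.single i₀ 1) l : F) / t i₀) = (a (Pi.single i 1) l : ↥D) := by
      rw [← mul_div_assoc, ← hrel i i₀ l, mul_div_cancel_left₀ _ hi₀F]
    rw [this]
    exact mem_mlocSet.2 ⟨1, S.one_mem, by simp⟩
  have hsum : φ (t i₀ : F) * c =
      ∑ l, φ (a (Pi.single i₀ 1) l : F) * (y (Finsupp.single l 1) : ↥A) := by
    rw [← hx i₀, hxy, LinearMap.comp_apply]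
    conv_lhs => rw [← Finsupp.univ_sum_single (a (Pi.single i₀ 1)), map_sum]
    rw [AddSubmonoidClass.coe_finsetSum]
    refine Finset.sum_congr rfl fun l _ => ?_
    rw [← hsmul, ← map_smul, Finsupp.smul_single, smul_eq_mul, mul_one]
  have hc' : c = ∑ l, φ ((a (Pi.single i₀ 1) l : F) / t i₀) * (y (Finsupp.single l 1) : ↥A) := by
    have hφ : φ (t i₀ : F) ≠ 0 := (map_ne_zero φ).2 hi₀F
    apply mul_left_cancel₀ hφ
    rw [hsum, Finset.mul_sum]
    refine Finset.sum_congr rfl fun l _ => ?_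
    rw [← mul_assoc, ← map_mul, mul_div_cancel₀ _ hi₀F]
  rw [hc']
  exact Subring.sum_mem _ fun l _ =>
    Subring.mul_mem _ (map_mem_locExt h (hy l)) (le_locExt (y (Finsupp.single l 1)).2)

theorem mem_locExt_of_forall_mul_mem_locExt {D : Subring F} {φ : F →+* L} {A : Subring L}
    {h : ExtMem D φ A} (hA : ExtFlat D φ A h) {S : Submonoid ↥D} {ι : Type} [Fintype ι]
    {t : ι → ↥D} (ht : ∃ i, t i ≠ 0)
    (hJ : ∀ y : F, (∀ i, (t i : F) * y ∈ mlocSet D ↑S) → y ∈ mlocSet D ↑S) {c : L}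
    (hc : ∀ i, φ (t i : F) * c ∈ locExt D φ A h S) : c ∈ locExt D φ A h S := by
  choose s hs hsc using hc
  refine mem_locExt_of_mul_mem (S.prod_mem fun i _ => hs i : ∏ i, s i ∈ S)
    (mem_locExt_of_forall_mul_mem hA ht hJ fun i => ?_)
  obtain ⟨r, hr⟩ := Finset.dvd_prod_of_mem s (Finset.mem_univ i)
  convert A.mul_mem (h r) (hsc i) using 1
  rw [hr]
  push_cast
  rw [map_mul]
  ring

theorem extMem_id (D : Subring F) : ExtMem D (RingHom.id F) D := fun d => d.2

theorem coe_locExt_id (D : Subring F) (S : Submonoid ↥D) :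
    (↑(locExt D (RingHom.id F) D (extMem_id D) S) : Set F) = mlocSet D ↑S := by
  ext x
  exact mem_mlocSet.symm

theorem coe_primeLoc (D : Subring F) (p : Ideal ↥D) (hp : p.IsPrime) :
    (↑(primeLoc D p hp) : Set F) = mlocSet D ↑p.primeCompl :=
  rfl

theorem IsQuotField.mono {A B : Subring F} (hAB : A ≤ B) (hA : IsQuotField A) :
    IsQuotField B := fun x => by
  obtain ⟨a, b, hb, hx⟩ := hA x
  exact ⟨⟨a, hAB a.2⟩, ⟨b, hAB b.2⟩, fun h =>
    hb (Subtype.ext (congrArg (fun z : ↥B => (z : F)) h)), hx⟩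

theorem PFReg.plReg {D : Subring F} (hqf : IsQuotField D) (hD : PFReg D) : PLReg D := by
  intro S h0
  have hle := le_locExt (h := extMem_id D) (S := S)
  have hreg := hD F (RingHom.id F) (locExt D (RingHom.id F) D (extMem_id D) S)
    (fun d => hle d.2) (hqf.mono hle)
    (extFlat_of_isLocalization hle h0 fun x => Iff.rfl)
  ext f
  constructor
  · intro hf
    have hf' : f ∈ IntOn (RingHom.id F '' ↑D)
        ↑(locExt D (RingHom.id F) D (extMem_id D) S) := by
      rintro _ ⟨d, hd, rfl⟩
      rw [coe_locExt_id]
      exact hf d (mem_mlocSet.2 ⟨1, S.one_mem, by simpa using hd⟩)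
    rw [hreg] at hf'
    obtain ⟨s, hs, hsf⟩ := exists_C_mul_mem_span (extMem_id D) (S := S) (fun b hb => hb)
      (U := IntR (↑D : Set F)) (fun t ht => ⟨1, S.one_mem, by simpa using ht⟩) hf'
    refine ⟨_, fun d hd => ?_, s, hs, rfl⟩
    exact span_subset_intOn (extMem_id D) hsf d ⟨d, hd, rfl⟩
  · rintro ⟨g, hg, s, hs, rfl⟩ x hx
    rw [← coe_locExt_id]
    refine eval_mem_of_mem_mlocSet (φ := RingHom.id F) (fun d => hle d.2)
      (fun s hs x hx => mem_locExt_of_mul_mem hs hx) ?_ hx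
    rintro _ ⟨d, hd, rfl⟩
    exact ⟨s, hs, by simpa using hg d hd⟩

theorem zero_notMem_primeCompl {D : Subring F} {p : Ideal ↥D} [p.IsPrime] :
    (0 : ↥D) ∉ p.primeCompl :=
  fun h => h p.zero_mem

theorem mem_of_map_mul_mem {D R : Subring F} {S : Submonoid ↥D} (h0 : (0 : ↥D) ∉ S)
    (hR : ∀ x, x ∈ R ↔ ∃ s ∈ S, (s : F) * x ∈ D) {φ : F →+* L} {B : Subring L}
    (hB : ExtMem R φ B) {s : ↥D} (hs : s ∈ S) {x : L} (hx : φ (s : F) * x ∈ B) : x ∈ B := by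
  have hs0 : (s : F) ≠ 0 := fun h => h0 (by
    have : s = 0 := Subtype.ext h
    rwa [this] at hs)
  have hinv : (s : F)⁻¹ ∈ R := (hR _).2 ⟨s, hs, by
    rw [mul_inv_cancel₀ hs0]; exact D.one_mem⟩
  have := B.mul_mem (hB ⟨_, hinv⟩) hx
  rwa [← mul_assoc, ← map_mul, inv_mul_cancel₀ hs0, map_one, one_mul] at this

theorem PFReg.primeLoc {D : Subring F} (hD : PFReg D) (p : Ideal ↥D) (hp : p.IsPrime) :
    PFReg (primeLoc D p hp) := by
  intro L _ φ A h hA hflat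
  have hR : ∀ x, x ∈ IVP.primeLoc D p hp ↔ ∃ s ∈ p.primeCompl, (s : F) * x ∈ D :=
    fun x => mem_mlocSet
  have hle : D ≤ IVP.primeLoc D p hp := fun x hx =>
    (hR x).2 ⟨1, Submonoid.one_mem _, by simpa using hx⟩
  have hreg := hD L φ A _ hA (hflat.of_isLocalization hle zero_notMem_primeCompl hR)
  refine Set.Subset.antisymm (fun f hf => ?_) (span_subset_intOn h)
  have hf' : f ∈ IntOn (φ '' ↑D) ↑A := by
    rintro _ ⟨d, hd, rfl⟩
    exact hf _ ⟨d, hle hd, rfl⟩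
  rw [hreg] at hf'
  refine Submodule.span_mono (Set.image_mono fun g hg x hx => ?_) hf'
  refine eval_mem_of_mem_mlocSet (φ := RingHom.id F) (S := p.primeCompl) (fun d => hle d.2)
    (fun s hs x hx => mem_of_map_mul_mem (φ := RingHom.id F) zero_notMem_primeCompl hR
      (fun d => d.2) hs hx) ?_ hx
  rintro _ ⟨d, hd, rfl⟩
  exact hle (hg d hd)

theorem mem_span_of_coeff_mem {D : Subring F} {φ : F →+* L} {B : Subring L} {f : L[X]}
    (hf : ∀ k, f.coeff k ∈ B) :
    f ∈ Submodule.span ↥B (Polynomial.map φ '' IntR (↑D : Set F)) := by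
  rw [f.as_sum_range_C_mul_X_pow]
  refine Submodule.sum_mem _ fun k _ => C_mul_mem_span (hf k) (Submodule.subset_span ?_)
  exact ⟨X ^ k, fun x hx => by rw [eval_pow, eval_X]; exact D.pow_mem hx k, by simp⟩

theorem exists_C_mul_mem_span_of_coeff_mem {D : Subring F} {φ : F →+* L} {A : Subring L}
    {h : ExtMem D φ A} {S : Submonoid ↥D} {f : L[X]} (hf : ∀ k, f.coeff k ∈ locExt D φ A h S) :
    ∃ s ∈ S, C (φ (s : F)) * f ∈
      Submodule.span ↥A (Polynomial.map φ '' IntR (↑D : Set F)) :=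
  exists_C_mul_mem_span h (fun _ hb => hb)
    (fun t ht => ⟨1, S.one_mem, by simpa using ht⟩) (mem_span_of_coeff_mem hf)

section TIdeals

variable {D : Subring F} {p : Ideal ↥D}

theorem self_subset_dv (D I : Set F) : I ⊆ dv D I :=
  fun y hy _ hz => by rw [mul_comm]; exact hz y hy

theorem self_subset_dt {D I : Set F} (hI : ∃ y ∈ I, y ≠ 0) : I ⊆ dt D I := by
  classical
  intro y hy
  obtain ⟨z, hz, hz0⟩ := hI
  refine ⟨{y, z}, ?_, ⟨z, by simp, hz0⟩, self_subset_dv _ _ (by simp)⟩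
  intro w hw
  simp only [Finset.coe_insert, Finset.coe_singleton, Set.mem_insert_iff,
    Set.mem_singleton_iff] at hw
  rcases hw with rfl | rfl <;> assumption

theorem plocIdl_subset_plocSet : plocIdl D p ⊆ plocSet D p :=
  fun _ ⟨y, _, s, hs, hx⟩ => ⟨y, s, hs, hx⟩

theorem coe_mem_plocIdl (hp : p.IsPrime) {y : ↥D} (hy : y ∈ p) : (y : F) ∈ plocIdl D p :=
  ⟨y, hy, 1, fun h => hp.ne_top ((Ideal.eq_top_iff_one p).2 h), by simp⟩

theorem mem_of_coe_mem_plocIdl (hp : p.IsPrime) {y : ↥D} (hy : (y : F) ∈ plocIdl D p) :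
    y ∈ p := by
  obtain ⟨z, hz, s, hs, h⟩ := hy
  have : s * y = z := Subtype.ext h
  exact (hp.mem_or_mem (this ▸ hz)).resolve_left hs

theorem dv_subset {I : Set F} (hI : I ⊆ ↑D) : dv ↑D I ⊆ ↑D := fun x hx => by
  simpa using hx 1 fun y hy => by simpa using hI hy

/-- A t-localizing maximal ideal is t-maximal. -/
theorem TLocalizing.isTMax (hp : p.IsMaximal) (h0 : ∃ y ∈ p, y ≠ 0) (h : TLocalizing D p) :
    IsTMax D p := by
  obtain ⟨y, hy, hy0⟩ := h0
  refine ⟨hp.ne_top, Set.Subset.antisymm ?_ (self_subset_dt ⟨y, ⟨y, hy, rfl⟩, fun h =>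
    hy0 (Subtype.ext h)⟩), fun q hq _ hpq => hp.eq_of_le hq hpq⟩
  rintro x ⟨T, hTp, hT0, hxT⟩
  have hxD : x ∈ D := dv_subset (hTp.trans fun _ ⟨a, _, ha⟩ => ha ▸ a.2) hxT
  refine ⟨⟨x, hxD⟩, mem_of_coe_mem_plocIdl hp.isPrime ?_, rfl⟩
  rw [← (h : dt _ _ = _)]
  refine ⟨T, fun z hz => ?_, hT0, fun z hz => ?_⟩
  · obtain ⟨a, ha, rfl⟩ := hTp hz
    exact coe_mem_plocIdl hp.isPrime ha
  · have hz' : ∀ t : T, ∃ s ∈ p.primeCompl, (s : F) * (z * t) ∈ D :=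
      fun t => mem_mlocSet.1 (hz t t.2)
    choose s hs hsz using hz'
    have hmem : ((∏ t, s t : ↥D) : F) * z ∈ dinv ↑D ↑T := fun w hw => by
      obtain ⟨r, hr⟩ := Finset.dvd_prod_of_mem s (Finset.mem_univ (⟨w, hw⟩ : T))
      change _ ∈ D
      convert D.mul_mem r.2 (hsz ⟨w, hw⟩) using 1
      rw [hr]
      push_cast
      ring
    refine mem_mlocSet.2 ⟨∏ t, s t, Submonoid.prod_mem p.primeCompl fun t _ => hs t, ?_⟩
    have := hxT _ hmem
    rwa [mul_left_comm] at this

/-- If `pD_p` is not a t-ideal, then it contains a finite set whose inverse is `D_p`. -/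
theorem exists_of_not_tLocalizing [hp : p.IsPrime] (h0 : ∃ y ∈ p, y ≠ 0)
    (h : ¬ TLocalizing D p) :
    ∃ (ι : Type) (_ : Fintype ι) (t : ι → ↥D), (∀ i, t i ∈ p) ∧ (∃ i, t i ≠ 0) ∧
      ∀ y : F, (∀ i, (t i : F) * y ∈ mlocSet D ↑p.primeCompl) →
        y ∈ mlocSet D ↑p.primeCompl := by
  obtain ⟨y, hy, hy0⟩ := h0
  have hsub : ¬ dt (plocSet D p) (plocIdl D p) ⊆ plocIdl D p := fun hsub =>
    h (Set.Subset.antisymm hsub (self_subset_dt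
      ⟨y, coe_mem_plocIdl hp hy, fun h => hy0 (Subtype.ext h)⟩))
  obtain ⟨x, ⟨T, hTp, ⟨w, hwT, hw0⟩, hxT⟩, hx⟩ := Set.not_subset.1 hsub
  have hxR : x ∈ IVP.primeLoc D p hp :=
    dv_subset (D := IVP.primeLoc D p hp) (hTp.trans plocIdl_subset_plocSet) hxT
  obtain ⟨a, s, hs, hsx⟩ := hxR
  have ha : a ∈ p.primeCompl := fun ha => hx ⟨a, ha, s, hs, hsx⟩
  choose t ht r hr hrt using fun i : T => hTp i.2
  have hcancel : ∀ u ∈ p.primeCompl, ∀ z : F, (u : F) * z ∈ mlocSet D ↑p.primeCompl →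
      z ∈ mlocSet D ↑p.primeCompl := fun u hu z hz => by
    rw [← coe_locExt_id] at hz ⊢
    exact mem_locExt_of_mul_mem hu hz
  have hmul : ∀ u : ↥D, ∀ z : F, z ∈ mlocSet D ↑p.primeCompl →
      (u : F) * z ∈ mlocSet D ↑p.primeCompl := fun u z hz => by
    rw [← coe_locExt_id] at hz ⊢
    exact Subring.mul_mem _ (le_locExt u.2) hz
  refine ⟨T, inferInstance, t, ht, ⟨⟨w, hwT⟩, fun htw => ?_⟩, fun z hz => ?_⟩
  · have h1 := hrt ⟨w, hwT⟩
    rw [htw, ZeroMemClass.coe_zero] at h1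
    refine hr ⟨w, hwT⟩ ?_
    have : r ⟨w, hwT⟩ = 0 := Subtype.ext ((mul_eq_zero.1 h1).resolve_right hw0)
    rw [this]
    exact p.zero_mem
  · have hzT : z ∈ dinv (plocSet D p) ↑T := fun v hv => hcancel _ (hr ⟨v, hv⟩) _ (by
      have := hz ⟨v, hv⟩
      rwa [← hrt ⟨v, hv⟩, mul_assoc, mul_comm v z] at this)
    refine hcancel a ha z ?_
    rw [← hsx, mul_assoc]
    exact hmul s _ (hxT z hzT)

end TIdeals

variable {D : Subring F} {φ : F →+* L} {A : Subring L} {f : L[X]} {p : Ideal ↥D}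

theorem exists_of_infinite_quotient (h : ExtMem D φ A) [hp : p.IsPrime] [Infinite (↥D ⧸ p)]
    (hf : f ∈ IntOn (φ '' ↑D) ↑A) :
    ∃ s ∈ p.primeCompl, C (φ (s : F)) * f ∈
      Submodule.span ↥A (Polynomial.map φ '' IntR (↑D : Set F)) := by
  obtain ⟨d, hd⟩ := exists_det_vandermonde_notMem hp (f.natDegree + 1)
  exact exists_C_mul_mem_span_of_coeff_mem (h := h) fun k =>
    ⟨_, hd, det_vandermonde_mul_coeff_mem h d (Nat.lt_succ_self _) hf k⟩

theorem exists_of_not_tLocalizing_of_flat {h : ExtMem D φ A} (hA : ExtFlat D φ A h)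
    [hp : p.IsPrime] (h0 : ∃ y ∈ p, y ≠ 0) (ht : ¬ TLocalizing D p)
    (hf : f ∈ IntOn (φ '' ↑D) ↑A) :
    ∃ s ∈ p.primeCompl, C (φ (s : F)) * f ∈
      Submodule.span ↥A (Polynomial.map φ '' IntR (↑D : Set F)) := by
  obtain ⟨ι, _, t, htp, ht0, hJ⟩ := exists_of_not_tLocalizing h0 ht
  refine exists_C_mul_mem_span_of_coeff_mem (h := h) fun k => ?_
  choose N u hu hdet using fun i => exists_det_vandermonde_pow hp (htp i) (f.natDegree + 1)
  refine mem_of_forall_pow_mul_mem (u := fun i => φ (t i : F))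
    (B := ↑(locExt D φ A h p.primeCompl))
    (fun i c hc => Subring.mul_mem _ (le_locExt (h (t i))) hc)
    (fun c hc => mem_locExt_of_forall_mul_mem_locExt hA ht0 hJ hc) N fun i => ?_
  refine ⟨u i, hu i, ?_⟩
  have := det_vandermonde_mul_coeff_mem h (fun j : Fin (f.natDegree + 1) => t i ^ (j : ℕ))
    (Nat.lt_succ_self _) hf k
  rw [hdet] at this
  push_cast at this
  rw [map_mul, map_pow, mul_comm (φ (t i : F) ^ N i), mul_assoc] at this
  exact this

theorem exists_of_pfReg_primeLoc (hqA : IsQuotField A) {h : ExtMem D φ A}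
    (hA : ExtFlat D φ A h) (hL : PLReg D) [hp : p.IsPrime] (hreg : PFReg (primeLoc D p hp))
    (hf : f ∈ IntOn (φ '' ↑D) ↑A) :
    ∃ s ∈ p.primeCompl, C (φ (s : F)) * f ∈
      Submodule.span ↥A (Polynomial.map φ '' IntR (↑D : Set F)) := by
  have hR : ∀ x, x ∈ primeLoc D p hp ↔ ∃ s ∈ p.primeCompl, (s : F) * x ∈ D :=
    fun x => mem_mlocSet
  have hle : D ≤ primeLoc D p hp := fun x hx =>
    (hR x).2 ⟨1, Submonoid.one_mem _, by simpa using hx⟩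
  have hext : ExtMem (primeLoc D p hp) φ (locExt D φ A h p.primeCompl) :=
    fun d => map_mem_locExt h d.2
  have hAle := le_locExt (h := h) (S := p.primeCompl)
  have hpr := hreg L φ (locExt D φ A h p.primeCompl) hext (hqA.mono hAle)
    (hA.localize hle zero_notMem_primeCompl hR hext)
  have hf' : f ∈ IntOn (φ '' ↑(primeLoc D p hp)) ↑(locExt D φ A h p.primeCompl) := by
    rintro _ ⟨x, hx, rfl⟩
    refine eval_mem_of_mem_mlocSet (fun d => hAle (h d))
      (fun s hs x hx => mem_locExt_of_mul_mem hs hx) ?_ hx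
    exact fun y hy => hAle (hf y hy)
  rw [hpr, coe_primeLoc, hL p.primeCompl zero_notMem_primeCompl] at hf'
  exact exists_C_mul_mem_span h (fun _ hb => hb)
    (S := p.primeCompl) (T := mlocPoly D ↑p.primeCompl (IntR ↑D))
    (by rintro _ ⟨g, hg, s, hs, hgs⟩; exact ⟨s, hs, hgs ▸ hg⟩) hf'

theorem mem_span_of_forall_isMaximal (h : ExtMem D φ A) {T : Set L[X]}
    (hf : ∀ p : Ideal ↥D, p.IsMaximal →
      ∃ s ∉ p, C (φ (s : F)) * f ∈ Submodule.span ↥A T) :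
    f ∈ Submodule.span ↥A T := by
  let I : Ideal ↥D :=
    { carrier := {s | C (φ (s : F)) * f ∈ Submodule.span ↥A T}
      zero_mem' := by simp
      add_mem' := fun {a b} ha hb => by
        simpa [add_mul] using Submodule.add_mem _ ha hb
      smul_mem' := fun c a ha => by
        simpa [mul_assoc] using C_mul_mem_span (h c) ha }
  by_contra hfm
  have hI : I ≠ ⊤ := fun hI => hfm (by
    have : (1 : ↥D) ∈ I := hI ▸ Submodule.mem_top
    simpa [I] using this)
  obtain ⟨p, hp, hIp⟩ := Ideal.exists_le_maximal I hI
  obtain ⟨s, hs, hsf⟩ := hf p hp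
  exact hs (hIp hsf)

theorem exists_ne_zero_mem_of_isMaximal (hqf : IsQuotField D) (hne : (↑D : Set F) ≠ Set.univ)
    (hp : p.IsMaximal) : ∃ y ∈ p, y ≠ 0 := by
  by_contra! h
  refine hne (Set.eq_univ_of_forall fun x => ?_)
  obtain ⟨a, b, hb, hx⟩ := hqf x
  obtain ⟨c, i, hi, hc⟩ := hp.exists_inv (fun hbp => hb (h b hbp))
  rw [h i hi, add_zero] at hc
  have hc' : (c : F) * b = 1 := congrArg Subtype.val hc
  have : x = (c : F) * a := by rw [← hx, ← mul_assoc, hc', one_mul]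
  rw [this]
  exact D.mul_mem c.2 a.2

end IVP

/-- `D` is polynomially F-regular iff `D` is polynomially L-regular
and `D_p` is polynomially F-regular for every t-localizing t-maximal ideal `p` of `D`
with finite residue field. -/
theorem stmt_16 (F : Type) [Field F] (D : Subring F)
    (hqf : IsQuotField D) (hne : (↑D : Set F) ≠ Set.univ) :
    PFReg D ↔
      PLReg D ∧ ∀ p : Ideal ↥D, ∀ hp : p.IsPrime, IsTMax D p → TLocalizing D p →
        Finite (↥D ⧸ p) → PFReg (primeLoc D p hp) := by
  refine ⟨fun h => ⟨h.plReg hqf, fun p hp _ _ _ => h.primeLoc p hp⟩, ?_⟩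
  rintro ⟨hL, hloc⟩ L _ φ A h hqA hA
  refine Set.Subset.antisymm (fun f hf => ?_) (span_subset_intOn h)
  refine mem_span_of_forall_isMaximal h fun p hp => ?_
  have hprime := hp.isPrime
  have h0 := exists_ne_zero_mem_of_isMaximal hqf hne hp
  rcases finite_or_infinite (↥D ⧸ p) with hfin | _
  · by_cases ht : TLocalizing D p
    · exact exists_of_pfReg_primeLoc hqA hA hL (hloc p hprime (ht.isTMax hp h0) ht hfin) hf
    · exact exists_of_not_tLocalizing_of_flat hA h0 ht hf
  · exact exists_of_infinite_quotient h hf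
end
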